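/- arXiv:1411.7249 — 4 statements merged into one kernel-verified Lean document; each statement's English description precedes it below -/
import Mathlib

section
/- Let n₁, n₂ be positive integers, (λ_{i,j})_{1≤i≤n₁, 1≤j≤n₂} real numbers, and define the linear forms L_i(u₁,…,u_{n₂}) := ∑_{j=1}^{n₂} λ_{i,j}u_j for 1 ≤ i ≤ n₁ and L^t_j(u₁,…,u_{n₁}) := ∑_{i=1}^{n₁} λ_{i,j}u_i for 1 ≤ j ≤ n₂. Let a₁,…,a_{n₂}, b₁,…,b_{n₁} > 1 be reals. For 0 ≤ Z ≤ 1 set U(Z) := #{(u₁,…,u_{n₂+n₁}) ∈ ℤ^{n₁+n₂} : |u_j| ≤ a_j·Z for all 1 ≤ j ≤ n₂ and |L_i(u₁,…,u_{n₂}) − u_{n₂+i}| ≤ b_i^{−1}·Z for all 1 ≤ i ≤ n₁}, and U^t(Z) := #{(u₁,…,u_{n₁+n₂}) ∈ ℤ^{n₁+n₂} : |u_i| ≤ b_i·Z for all 1 ≤ i ≤ n₁ and |L^t_j(u₁,…,u_{n₁}) − u_{n₁+j}| ≤ a_j^{−1}·Z for all 1 ≤ j ≤ n₂}. Then for all 0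 < Z₁ ≤ Z₂ ≤ 1: U(Z₂) ≪_{n₁,n₂} max( (Z₂/Z₁)^{n₂}·U(Z₁), (Z₂^{n₂}/Z₁^{n₁})·(∏_{j=1}^{n₂} a_j / ∏_{i=1}^{n₁} b_i)·U^t(Z₁) ), where the implied constant depends only on n₁ and n₂. -/
/-!
Statement 8 (geometry of numbers, generalization of Davenport's Lemma 12.6 /
Schindler's Lemma 3.1): for positive integers `n₁, n₂`, real numbers `λ_{i,j}`,
linear forms `L_i(u) = ∑_j λ_{i,j} u_j` and `Lᵗ_j(u) = ∑_i λ_{i,j} u_i`,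
reals `a₁,…,a_{n₂}, b₁,…,b_{n₁} > 1`, and counting functions `U(Z)`, `Uᵗ(Z)` as below,
one has for all `0 < Z₁ ≤ Z₂ ≤ 1`:
`U(Z₂) ≪_{n₁,n₂} max((Z₂/Z₁)^{n₂} U(Z₁), (Z₂^{n₂}/Z₁^{n₁}) (∏ a_j / ∏ b_i) Uᵗ(Z₁))`.
-/

open scoped BigOperators

/-- `U(Z)`: the number of integer points `(u₁,…,u_{n₂}, u_{n₂+1},…,u_{n₂+n₁})` with
`|u_j| ≤ a_j Z` for `1 ≤ j ≤ n₂` and `|L_i(u₁,…,u_{n₂}) - u_{n₂+i}| ≤ b_i⁻¹ Z` for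
`1 ≤ i ≤ n₁`. -/
noncomputable def latticeCount (n₁ n₂ : ℕ) (lam : Fin n₁ → Fin n₂ → ℝ)
    (a : Fin n₂ → ℝ) (b : Fin n₁ → ℝ) (Z : ℝ) : ℕ :=
  Set.ncard {u : (Fin n₂ → ℤ) × (Fin n₁ → ℤ) |
    (∀ j, |(u.1 j : ℝ)| ≤ a j * Z) ∧
    (∀ i, |(∑ j, lam i j * (u.1 j : ℝ)) - (u.2 i : ℝ)| ≤ (b i)⁻¹ * Z)}

open Real in
theorem summable_exp_neg_mul_int_sq {c : ℝ} (hc : 0 < c) :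
    Summable fun n : ℤ => exp (-(c * (n : ℝ) ^ 2)) := by
  have h := summable_pow_mul_jacobiTheta₂_term_bound 0 (div_pos hc pi_pos) 0
  refine h.congr fun n => ?_
  have := pi_ne_zero
  simp only [pow_zero, one_mul, mul_zero, zero_mul, sub_zero]
  congr 1
  field_simp

theorem summable_norm_prod_and_tsum_prod {α : Type*} :
    ∀ {n : ℕ} (f : Fin n → α → ℂ), (∀ i, Summable fun x => ‖f i x‖) →
      (Summable fun v : Fin n → α => ‖∏ i, f i (v i)‖) ∧
        ∑' v : Fin n → α, ∏ i, f i (v i) = ∏ i, ∑' x, f i x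
  | 0, _, _ => by
    refine ⟨Summable.of_finite, ?_⟩
    simp
  | n + 1, f, hf => by
    obtain ⟨hs, ht⟩ :=
      summable_norm_prod_and_tsum_prod (fun i : Fin n => f i.succ) fun i => hf i.succ
    have key : ∀ z : α × (Fin n → α),
        ∏ i, f i (Fin.consEquiv (fun _ => α) z i) = f 0 z.1 * ∏ i : Fin n, f i.succ (z.2 i) := by
      intro z
      rw [Fin.prod_univ_succ]
      simp [Fin.consEquiv]
    constructor
    · rw [← (Fin.consEquiv fun _ => α).summable_iff]
      refine (Summable.mul_norm (hf 0) hs).congr fun z => ?_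
      simp only [Function.comp_apply, key]
    · rw [← (Fin.consEquiv fun _ => α).tsum_eq, Fin.prod_univ_succ, ← ht,
        tsum_mul_tsum_of_summable_norm (hf 0) hs]
      exact tsum_congr key

theorem summable_gaussian_shift {B : ℝ} (hB : 0 < B) (x : ℝ) :
    Summable fun n : ℤ => Real.exp (-(Real.pi * (B * (x - n)) ^ 2)) := by
  have hc : 0 < Real.pi * B ^ 2 / 2 := by have := Real.pi_pos; positivity
  refine Summable.of_nonneg_of_le (fun _ => (Real.exp_pos _).le) (fun n => ?_)
    ((summable_exp_neg_mul_int_sq hc).mul_left (Real.exp (Real.pi * B ^ 2 * x ^ 2)))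
  rw [← Real.exp_add, Real.exp_le_exp]
  have : 0 ≤ Real.pi * B ^ 2 / 2 * (2 * x - n) ^ 2 := by positivity
  nlinarith

theorem poisson_gaussian {B : ℝ} (hB : 0 < B) (x : ℝ) :
    ((∑' n : ℤ, Real.exp (-(Real.pi * (B * (x - n)) ^ 2)) : ℝ) : ℂ) =
      (B : ℂ)⁻¹ * ∑' h : ℤ, (Real.exp (-(Real.pi * (h / B) ^ 2)) : ℂ) *
        Complex.exp (2 * Real.pi * Complex.I * (h * x)) := by
  have hBC : (B : ℂ) ≠ 0 := by exact_mod_cast hB.ne'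
  have ha : 0 < (((B⁻¹ ^ 2 : ℝ)) : ℂ).re := by
    rw [Complex.ofReal_re]; positivity
  have h := Complex.tsum_exp_neg_quadratic ha (Complex.I * x)
  have hsq : (((B⁻¹ ^ 2 : ℝ)) : ℂ) ^ (1 / 2 : ℂ) = (B : ℂ)⁻¹ := by
    have : ((1 / 2 : ℂ)) = ((1 / 2 : ℝ) : ℂ) := by norm_num
    rw [this, ← Complex.ofReal_cpow (by positivity), ← Real.sqrt_eq_rpow,
      Real.sqrt_sq (by positivity)]
    simp
  rw [hsq] at h
  rw [Complex.ofReal_tsum]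
  have h1 : ∀ n : ℤ, (Real.exp (-(Real.pi * (n / B) ^ 2)) : ℂ) *
      Complex.exp (2 * Real.pi * Complex.I * (n * x)) =
      Complex.exp (-Real.pi * ((B⁻¹ ^ 2 : ℝ) : ℂ) * n ^ 2 +
        2 * Real.pi * (Complex.I * x) * n) := by
    intro n
    push_cast
    rw [← Complex.exp_add]
    congr 1
    field_simp
  have h2 : ∀ n : ℤ, ((Real.exp (-(Real.pi * (B * (x - n)) ^ 2)) : ℝ) : ℂ) =
      Complex.exp (-Real.pi / ((B⁻¹ ^ 2 : ℝ) : ℂ) * (n + Complex.I * (Complex.I * x)) ^ 2) := by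
    intro n
    push_cast
    congr 1
    rw [← mul_assoc Complex.I, Complex.I_mul_I]
    field_simp
    ring
  rw [tsum_congr h1, tsum_congr h2, h]
  field_simp

open MeasureTheory Metric Module in
theorem card_le_of_norm_le_of_separated {ι F : Type*} [NormedAddCommGroup F] [NormedSpace ℝ F]
    [FiniteDimensional ℝ F] (s : Finset ι) (f : ι → F) {R r : ℝ} (hR : 0 ≤ R) (hr : 0 < r)
    (hs : ∀ i ∈ s, ‖f i‖ ≤ R) (h : ∀ i ∈ s, ∀ j ∈ s, i ≠ j → r ≤ ‖f i - f j‖) :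
    (s.card : ℝ) ≤ (1 + 2 * R / r) ^ finrank ℝ F := by
  borelize F
  let μ : Measure F := Measure.addHaar
  have hδ : 0 < r / 2 := by positivity
  have hρ : 0 < R + r / 2 := by positivity
  have D : Set.PairwiseDisjoint (s : Set ι) (fun c => ball (f c) (r / 2)) := by
    intro c hc d hd hcd
    apply ball_disjoint_ball
    rw [dist_eq_norm, add_halves]
    exact h c hc d hd hcd
  have A_subset : (⋃ c ∈ s, ball (f c) (r / 2)) ⊆ ball (0 : F) (R + r / 2) := by
    refine Set.iUnion₂_subset fun x hx => ?_
    apply ball_subset_ball'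
    rw [dist_zero_right]
    linarith [hs x hx]
  have I : (s.card : ENNReal) * ENNReal.ofReal ((r / 2) ^ finrank ℝ F) * μ (ball 0 1) ≤
      ENNReal.ofReal ((R + r / 2) ^ finrank ℝ F) * μ (ball 0 1) :=
    calc
      _ = μ (⋃ c ∈ s, ball (f c) (r / 2)) := by
        rw [measure_biUnion_finset D fun c _ => measurableSet_ball]
        simp only [μ.addHaar_ball_of_pos _ hδ]
        simp only [Finset.sum_const, nsmul_eq_mul, mul_assoc]
      _ ≤ μ (ball (0 : F) (R + r / 2)) := measure_mono A_subset
      _ = _ := by simp only [μ.addHaar_ball_of_pos _ hρ]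
  have J := (ENNReal.mul_le_mul_iff_left (measure_ball_pos μ _ zero_lt_one).ne'
    measure_ball_lt_top.ne).1 I
  have K := ENNReal.toReal_le_of_le_ofReal (pow_nonneg hρ.le _) J
  rw [ENNReal.toReal_mul, ENNReal.toReal_natCast, ENNReal.toReal_ofReal (by positivity)] at K
  have e : (1 + 2 * R / r) = (R + r / 2) / (r / 2) := by field_simp; ring
  rw [e, div_pow, le_div_iff₀ (by positivity)]
  exact K

open Module in
theorem card_le_mul_of_mem_submodule {G E : Type*} [AddCommGroup G] [NormedAddCommGroup E]
    [NormedSpace ℝ E] [FiniteDimensional ℝ E] (ψ : G →+ E) (V : Submodule ℝ E) {R r : ℝ}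
    (hR : 0 ≤ R) (hr : 0 < r) (N : ℕ)
    (hN : ∀ t : Finset G, (∀ w ∈ t, ‖ψ w‖ ≤ r) → t.card ≤ N) (s : Finset G)
    (hs : ∀ w ∈ s, ψ w ∈ V ∧ ‖ψ w‖ ≤ R) :
    (s.card : ℝ) ≤ (1 + 2 * R / r) ^ finrank ℝ V * N := by
  classical
  let P : Finset G → Prop := fun T => ∀ c ∈ T, ∀ d ∈ T, c ≠ d → r ≤ ‖ψ c - ψ d‖
  obtain ⟨T, hT, hmax⟩ := (s.powerset.filter P).exists_max_image Finset.card
    ⟨∅, by simp [P]⟩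
  simp only [Finset.mem_filter, Finset.mem_powerset] at hT hmax
  obtain ⟨hTs, hTP⟩ := hT
  have hcover : ∀ w ∈ s, ∃ t ∈ T, ‖ψ w - ψ t‖ ≤ r := by
    intro w hw
    by_contra! hcon
    have hwT : w ∉ T := fun hwT => by
      have := hcon w hwT
      simp at this
      linarith
    have := hmax (insert w T) ⟨Finset.insert_subset hw hTs, by
      intro c hc d hd hcd
      rcases Finset.mem_insert.1 hc with rfl | hc' <;>
        rcases Finset.mem_insert.1 hd with rfl | hd'
      · exact absurd rfl hcd
      · exact (hcon d hd').le
      · rw [norm_sub_rev]; exact (hcon c hc').le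
      · exact hTP c hc' d hd' hcd⟩
    rw [Finset.card_insert_of_notMem hwT] at this
    omega
  have hTcard : (T.card : ℝ) ≤ (1 + 2 * R / r) ^ finrank ℝ V := by
    rw [← T.card_attach]
    refine card_le_of_norm_le_of_separated T.attach
      (fun t => (⟨ψ t, (hs t (hTs t.2)).1⟩ : V)) hR hr (fun t _ => (hs t (hTs t.2)).2) ?_
    intro i _ j _ hij
    exact hTP i i.2 j j.2 fun h => hij (Subtype.ext h)
  have hscard : s.card ≤ N * T.card := by
    choose! g hg using hcover
    refine Finset.card_le_mul_card_image_of_maps_to (f := g) (fun w hw => (hg w hw).1) N ?_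
    intro t _
    rw [← Finset.card_image_of_injective _ (sub_left_injective (b := t))]
    refine hN _ fun w hw => ?_
    obtain ⟨w', hw', rfl⟩ := Finset.mem_image.1 hw
    obtain ⟨h1, rfl⟩ := Finset.mem_filter.1 hw'
    rw [map_sub]
    exact (hg w' h1).2
  calc (s.card : ℝ) ≤ N * T.card := by exact_mod_cast hscard
    _ ≤ N * (1 + 2 * R / r) ^ finrank ℝ V := by gcongr
    _ = _ := mul_comm _ _

/-- The Gaussian weight `exp (-π ‖x‖₂²)` on `ℝᵖ × ℝ^q`. -/
noncomputable def gaussWeight {p q : ℕ} (x : (Fin p → ℝ) × (Fin q → ℝ)) : ℝ :=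
  (∏ j, Real.exp (-(Real.pi * x.1 j ^ 2))) * ∏ i, Real.exp (-(Real.pi * x.2 i ^ 2))

theorem gaussWeight_pos {p q : ℕ} (x : (Fin p → ℝ) × (Fin q → ℝ)) : 0 < gaussWeight x :=
  mul_pos (Finset.prod_pos fun _ _ => Real.exp_pos _) (Finset.prod_pos fun _ _ => Real.exp_pos _)

theorem exp_neg_le_gaussWeight {p q : ℕ} {x : (Fin p → ℝ) × (Fin q → ℝ)} (hx : ‖x‖ ≤ 1) :
    Real.exp (-Real.pi) ^ (p + q) ≤ gaussWeight x := by
  have h : ∀ {n : ℕ} (y : Fin n → ℝ), ‖y‖ ≤ 1 →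
      Real.exp (-Real.pi) ^ n ≤ ∏ j, Real.exp (-(Real.pi * y j ^ 2)) := by
    intro n y hy
    rw [← Fin.prod_const]
    refine Finset.prod_le_prod (fun _ _ => (Real.exp_pos _).le) fun j _ => ?_
    rw [Real.exp_le_exp]
    have h1 : |y j| ≤ 1 := (norm_le_pi_norm y j).trans hy
    have h2 : y j ^ 2 ≤ 1 := (sq_le_one_iff_abs_le_one _).2 h1
    nlinarith [Real.pi_pos]
  rw [pow_add]
  exact mul_le_mul (h _ ((norm_fst_le x).trans hx)) (h _ ((norm_snd_le x).trans hx))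
    (by positivity) (Finset.prod_nonneg fun _ _ => (Real.exp_pos _).le)

theorem gaussian_le_exp_floor {c : ℝ} (hc : 0 < c) (y : ℝ) :
    Real.exp (-(Real.pi * y ^ 2)) ≤
      Real.exp (Real.pi * c ^ 2) * Real.exp (-(Real.pi * c ^ 2 / 2 * (⌊y / c⌋ : ℝ) ^ 2)) := by
  rw [← Real.exp_add, Real.exp_le_exp]
  have h1 : c * ⌊y / c⌋ ≤ y := by
    have := Int.floor_le (y / c); rw [le_div_iff₀ hc] at this; linarith
  have h2 : y < c * ⌊y / c⌋ + c := by
    have := Int.lt_floor_add_one (y / c); rw [div_lt_iff₀ hc] at this; linarith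
  set m := c * (⌊y / c⌋ : ℝ) with hm
  have h3 : m ^ 2 / 2 ≤ y ^ 2 + c ^ 2 := by
    have h4 : (y - m) ^ 2 ≤ c ^ 2 := by
      apply sq_le_sq'
      · linarith
      · linarith
    nlinarith [sq_nonneg (2 * y - m)]
  have h5 : Real.pi * c ^ 2 / 2 * (⌊y / c⌋ : ℝ) ^ 2 = Real.pi * (m ^ 2 / 2) := by
    rw [hm]; ring
  rw [h5]
  nlinarith [Real.pi_pos, mul_le_mul_of_nonneg_left h3 Real.pi_pos.le]

theorem summable_prod_of_nonneg_real {n : ℕ} {M : ℤ → ℝ} (h0 : ∀ k, 0 ≤ M k) (hM : Summable M) :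
    Summable fun v : Fin n → ℤ => ∏ i, M (v i) := by
  have := (summable_norm_prod_and_tsum_prod (fun (_ : Fin n) k => (M k : ℂ)) fun _ => by
    simpa [abs_of_nonneg, h0] using hM).1
  simpa [norm_prod, abs_of_nonneg, h0] using this

theorem abs_sub_le_of_floor_eq {c y z : ℝ} (hc : 0 < c) (h : ⌊y / c⌋ = ⌊z / c⌋) :
    |y - z| ≤ c := by
  have := Int.abs_sub_lt_one_of_floor_eq_floor h
  rw [← sub_div, abs_div, abs_of_pos hc, div_lt_one hc] at this
  exact this.le

theorem exists_summable_gaussian_le_floor {c : ℝ} (hc : 0 < c) :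
    ∃ M : ℤ → ℝ, (∀ k, 0 < M k) ∧ Summable M ∧
      ∀ y : ℝ, Real.exp (-(Real.pi * y ^ 2)) ≤ M ⌊y / c⌋ :=
  ⟨_, fun _ => mul_pos (Real.exp_pos _) (Real.exp_pos _),
    (summable_exp_neg_mul_int_sq (by have := Real.pi_pos; positivity)).mul_left _,
    gaussian_le_exp_floor hc⟩

theorem exists_summable_gaussWeight_le_floor (p q : ℕ) {c : ℝ} (hc : 0 < c) :
    ∃ W : (Fin p → ℤ) × (Fin q → ℤ) → ℝ, (∀ k, 0 < W k) ∧ Summable W ∧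
      ∀ x : (Fin p → ℝ) × (Fin q → ℝ),
        gaussWeight x ≤ W (fun j => ⌊x.1 j / c⌋, fun i => ⌊x.2 i / c⌋) := by
  obtain ⟨M, hMpos, hM, hgM⟩ := exists_summable_gaussian_le_floor hc
  have hP : ∀ {n : ℕ} (v : Fin n → ℤ), 0 < ∏ i, M (v i) := fun v =>
    Finset.prod_pos fun i _ => hMpos (v i)
  have hS : ∀ n : ℕ, Summable fun v : Fin n → ℤ => ∏ i, M (v i) := fun n =>
    summable_prod_of_nonneg_real (fun k => (hMpos k).le) hM
  have hg : ∀ {n : ℕ} (y : Fin n → ℝ),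
      ∏ i, Real.exp (-(Real.pi * y i ^ 2)) ≤ ∏ i, M ⌊y i / c⌋ := fun y =>
    Finset.prod_le_prod (fun i _ => (Real.exp_pos _).le) fun i _ => hgM (y i)
  have hN : ∀ n : ℕ, 0 ≤ fun v : Fin n → ℤ => ∏ i, M (v i) := fun n v => (hP v).le
  have hprod := (hS p).mul_of_nonneg (hS q) (hN p) (hN q)
  refine ⟨fun k => (∏ j, M (k.1 j)) * ∏ i, M (k.2 i), fun k => mul_pos (hP k.1) (hP k.2),
    hprod, fun x => ?_⟩
  exact mul_le_mul (hg x.1) (hg x.2) (Finset.prod_nonneg fun i _ => (Real.exp_pos _).le) (hP _).le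

theorem norm_sub_le_of_floor_eq {p q : ℕ} {c : ℝ} (hc : 0 < c)
    {x y : (Fin p → ℝ) × (Fin q → ℝ)} (h₁ : ∀ j, ⌊x.1 j / c⌋ = ⌊y.1 j / c⌋)
    (h₂ : ∀ i, ⌊x.2 i / c⌋ = ⌊y.2 i / c⌋) : ‖x - y‖ ≤ c := by
  rw [norm_prod_le_iff, pi_norm_le_iff_of_nonneg hc.le, pi_norm_le_iff_of_nonneg hc.le]
  exact ⟨fun j => abs_sub_le_of_floor_eq hc (h₁ j), fun i => abs_sub_le_of_floor_eq hc (h₂ i)⟩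

/-- A Gaussian sum over a lattice is controlled by the number of lattice points in a box. -/
theorem exists_sum_gaussWeight_le (p q : ℕ) {c : ℝ} (hc : 0 < c) :
    ∃ C : ℝ, 0 < C ∧ ∀ {G : Type} [AddCommGroup G] (ψ : G →+ (Fin p → ℝ) × (Fin q → ℝ)) (N : ℕ),
      (∀ t : Finset G, (∀ w ∈ t, ‖ψ w‖ ≤ c) → t.card ≤ N) →
        ∀ s : Finset G, ∑ w ∈ s, gaussWeight (ψ w) ≤ C * N := by
  classical
  obtain ⟨W, hWpos, hW, hle⟩ := exists_summable_gaussWeight_le_floor p q hc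
  refine ⟨∑' k, W k, hW.tsum_pos (fun k => (hWpos k).le) 0 (hWpos 0), ?_⟩
  intro G _ ψ N hN s
  obtain ⟨g, hg⟩ : ∃ g : G → (Fin p → ℤ) × (Fin q → ℤ), ∀ w,
      g w = (fun j => ⌊(ψ w).1 j / c⌋, fun i => ⌊(ψ w).2 i / c⌋) := ⟨_, fun _ => rfl⟩
  have hfiber : ∀ k, (s.filter fun w => g w = k).card ≤ N := by
    intro k
    rcases (s.filter fun w => g w = k).eq_empty_or_nonempty with h | ⟨w₀, hw₀⟩
    · simp [h]
    rw [← Finset.card_image_of_injective _ (sub_left_injective (b := w₀))]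
    refine hN _ fun w hw => ?_
    obtain ⟨w', hw', rfl⟩ := Finset.mem_image.1 hw
    have h : g w' = g w₀ := (Finset.mem_filter.1 hw').2.trans (Finset.mem_filter.1 hw₀).2.symm
    rw [hg, hg, Prod.mk.injEq] at h
    rw [map_sub]
    exact norm_sub_le_of_floor_eq hc (congrFun h.1) (congrFun h.2)
  calc ∑ w ∈ s, gaussWeight (ψ w) ≤ ∑ w ∈ s, W (g w) :=
        Finset.sum_le_sum fun w _ => by rw [hg]; exact hle _
    _ = ∑ k ∈ s.image g, ∑ w ∈ s with g w = k, W (g w) :=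
        (Finset.sum_fiberwise_of_maps_to (fun w hw => Finset.mem_image_of_mem g hw) _).symm
    _ ≤ ∑ k ∈ s.image g, W k * N := by
        refine Finset.sum_le_sum fun k _ => ?_
        rw [Finset.sum_congr rfl fun w hw => by rw [(Finset.mem_filter.1 hw).2],
          Finset.sum_const, nsmul_eq_mul, mul_comm]
        exact mul_le_mul_of_nonneg_left (by exact_mod_cast hfiber k) (hWpos k).le
    _ = (∑ k ∈ s.image g, W k) * N := (Finset.sum_mul _ _ _).symm
    _ ≤ (∑' k, W k) * N := by
        gcongr
        exact hW.sum_le_tsum _ fun k _ => (hWpos k).le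

/-- The lattice whose points in the box of radius `Z` are counted by `latticeCount`. -/
noncomputable def scaledLattice {p q : ℕ} (lam : Fin q → Fin p → ℝ) (a : Fin p → ℝ)
    (b : Fin q → ℝ) : (Fin p → ℤ) × (Fin q → ℤ) →+ (Fin p → ℝ) × (Fin q → ℝ) where
  toFun w := (fun j => w.1 j / a j, fun i => b i * (∑ j, lam i j * w.1 j - w.2 i))
  map_zero' := by ext <;> simp
  map_add' w w' := by
    ext
    · simp [add_div]
    · simp [mul_add, Finset.sum_add_distrib]; ring

theorem norm_scaledLattice_le_iff {p q : ℕ} (lam : Fin q → Fin p → ℝ) {a : Fin p → ℝ}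
    {b : Fin q → ℝ} (ha : ∀ j, 0 < a j) (hb : ∀ i, 0 < b i) {Z : ℝ} (hZ : 0 ≤ Z)
    (w : (Fin p → ℤ) × (Fin q → ℤ)) :
    ‖scaledLattice lam a b w‖ ≤ Z ↔ (∀ j, |(w.1 j : ℝ)| ≤ a j * Z) ∧
      ∀ i, |(∑ j, lam i j * (w.1 j : ℝ)) - (w.2 i : ℝ)| ≤ (b i)⁻¹ * Z := by
  rw [norm_prod_le_iff, pi_norm_le_iff_of_nonneg hZ, pi_norm_le_iff_of_nonneg hZ]
  refine and_congr (forall_congr' fun j => ?_) (forall_congr' fun i => ?_)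
  · simp only [scaledLattice, AddMonoidHom.coe_mk, ZeroHom.coe_mk, Real.norm_eq_abs, abs_div,
      abs_of_pos (ha j)]
    rw [div_le_iff₀' (ha j)]
  · simp only [scaledLattice, AddMonoidHom.coe_mk, ZeroHom.coe_mk, Real.norm_eq_abs, abs_mul,
      abs_of_pos (hb i)]
    rw [inv_mul_eq_div, le_div_iff₀' (hb i)]

theorem finite_norm_scaledLattice_le {p q : ℕ} (lam : Fin q → Fin p → ℝ) {a : Fin p → ℝ}
    {b : Fin q → ℝ} (ha : ∀ j, 0 < a j) (hb : ∀ i, 0 < b i) {Z : ℝ} (hZ : 0 ≤ Z) :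
    {w | ‖scaledLattice lam a b w‖ ≤ Z}.Finite := by
  classical
  let m : Fin p → ℤ := fun j => ⌈a j * Z⌉
  let n : Fin q → ℤ := fun i => ⌈(b i)⁻¹ * Z + ∑ j, |lam i j| * (a j * Z)⌉
  refine (Set.finite_Icc ((-m, -n) : (Fin p → ℤ) × (Fin q → ℤ)) (m, n)).subset fun w hw => ?_
  obtain ⟨h1, h2⟩ := (norm_scaledLattice_le_iff lam ha hb hZ w).1 hw
  have aux : ∀ (k : ℤ) (x : ℝ), |(k : ℝ)| ≤ x → -⌈x⌉ ≤ k ∧ k ≤ ⌈x⌉ := by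
    intro k x hk
    have := abs_le.1 (hk.trans (Int.le_ceil x))
    exact ⟨by exact_mod_cast this.1, by exact_mod_cast this.2⟩
  have hv : ∀ i, |(w.2 i : ℝ)| ≤ (b i)⁻¹ * Z + ∑ j, |lam i j| * (a j * Z) := by
    intro i
    have h3 : |∑ j, lam i j * (w.1 j : ℝ)| ≤ ∑ j, |lam i j| * (a j * Z) := by
      refine (Finset.abs_sum_le_sum_abs _ _).trans (Finset.sum_le_sum fun j _ => ?_)
      rw [abs_mul]
      exact mul_le_mul_of_nonneg_left (h1 j) (abs_nonneg _)
    have h4 := abs_sub_abs_le_abs_sub (w.2 i : ℝ) (∑ j, lam i j * (w.1 j : ℝ))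
    rw [abs_sub_comm] at h4
    linarith [h2 i]
  exact ⟨⟨fun j => (aux _ _ (h1 j)).1, fun i => (aux _ _ (hv i)).1⟩,
    ⟨fun j => (aux _ _ (h1 j)).2, fun i => (aux _ _ (hv i)).2⟩⟩

theorem latticeCount_eq_ncard {p q : ℕ} (lam : Fin q → Fin p → ℝ) {a : Fin p → ℝ}
    {b : Fin q → ℝ} (ha : ∀ j, 0 < a j) (hb : ∀ i, 0 < b i) {Z : ℝ} (hZ : 0 ≤ Z) :
    latticeCount q p lam a b Z = {w | ‖scaledLattice lam a b w‖ ≤ Z}.ncard := by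
  simp only [norm_scaledLattice_le_iff lam ha hb hZ]
  rfl

theorem card_le_latticeCount {p q : ℕ} (lam : Fin q → Fin p → ℝ) {a : Fin p → ℝ}
    {b : Fin q → ℝ} (ha : ∀ j, 0 < a j) (hb : ∀ i, 0 < b i) {Z : ℝ} (hZ : 0 ≤ Z)
    (t : Finset ((Fin p → ℤ) × (Fin q → ℤ))) (ht : ∀ w ∈ t, ‖scaledLattice lam a b w‖ ≤ Z) :
    t.card ≤ latticeCount q p lam a b Z := by
  rw [latticeCount_eq_ncard lam ha hb hZ, ← Set.ncard_coe_finset]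
  exact Set.ncard_le_ncard ht (finite_norm_scaledLattice_le lam ha hb hZ)

theorem scaledLattice_rescale {p q : ℕ} (lam : Fin q → Fin p → ℝ) (a : Fin p → ℝ) (b : Fin q → ℝ)
    {Z : ℝ} (hZ : 0 < Z) (w : (Fin p → ℤ) × (Fin q → ℤ)) :
    ‖scaledLattice lam (fun j => a j * Z) (fun i => b i / Z) w‖ =
      ‖scaledLattice lam a b w‖ / Z := by
  have : scaledLattice lam (fun j => a j * Z) (fun i => b i / Z) w =
      Z⁻¹ • scaledLattice lam a b w := by
    ext
    · simp [scaledLattice]; field_simp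
    · simp [scaledLattice]; field_simp
  rw [this, norm_smul, norm_inv, Real.norm_of_nonneg hZ.le, inv_mul_eq_div]

theorem summable_gaussWeight_scaledLattice {p q : ℕ} (lam : Fin q → Fin p → ℝ) {a : Fin p → ℝ}
    {b : Fin q → ℝ} (ha : ∀ j, 0 < a j) (hb : ∀ i, 0 < b i) :
    Summable fun w => gaussWeight (scaledLattice lam a b w) := by
  obtain ⟨C, -, hC⟩ := exists_sum_gaussWeight_le p q one_pos
  exact summable_of_sum_le (fun w => (gaussWeight_pos _).le)
    (hC (scaledLattice lam a b) _ (card_le_latticeCount lam ha hb zero_le_one))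

/-- The double exponential sum to which Poisson summation in the last `q` variables reduces the
Gaussian sum over `scaledLattice lam a b`. -/
noncomputable def dualTerm {p q : ℕ} (lam : Fin q → Fin p → ℝ) (a : Fin p → ℝ) (b : Fin q → ℝ)
    (u : Fin p → ℤ) (h : Fin q → ℤ) : ℂ :=
  ((∏ j, Real.exp (-(Real.pi * (u j / a j) ^ 2)) : ℝ) : ℂ) *
    ((∏ i, Real.exp (-(Real.pi * (h i / b i) ^ 2)) : ℝ) : ℂ) *
      Complex.exp (2 * Real.pi * Complex.I * ((∑ i, ∑ j, lam i j * u j * h i : ℝ) : ℂ))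

theorem dualTerm_transpose {p q : ℕ} (lam : Fin q → Fin p → ℝ) (a : Fin p → ℝ) (b : Fin q → ℝ)
    (u : Fin p → ℤ) (h : Fin q → ℤ) :
    dualTerm (fun j i => lam i j) b a h u = dualTerm lam a b u h := by
  unfold dualTerm
  rw [Finset.sum_comm, mul_comm (((∏ _, _ : ℝ)) : ℂ)]
  simp only [mul_right_comm]

theorem summable_prod_exp_div {n : ℕ} {a : Fin n → ℝ} (ha : ∀ j, 0 < a j) :
    Summable fun u : Fin n → ℤ => ∏ j, Real.exp (-(Real.pi * (u j / a j) ^ 2)) := by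
  have := (summable_norm_prod_and_tsum_prod
    (fun (j : Fin n) (k : ℤ) => (Real.exp (-(Real.pi * (k / a j) ^ 2)) : ℂ)) fun j => by
      have hc : 0 < Real.pi / a j ^ 2 := by have := Real.pi_pos; have := ha j; positivity
      refine (summable_exp_neg_mul_int_sq hc).congr fun k => ?_
      rw [Complex.norm_real, Real.norm_of_nonneg (Real.exp_pos _).le]
      congr 1
      ring).1
  refine this.congr fun u => ?_
  rw [norm_prod]
  exact Finset.prod_congr rfl fun j _ => by
    rw [Complex.norm_real, Real.norm_of_nonneg (Real.exp_pos _).le]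

theorem summable_dualTerm {p q : ℕ} (lam : Fin q → Fin p → ℝ) {a : Fin p → ℝ} {b : Fin q → ℝ}
    (ha : ∀ j, 0 < a j) (hb : ∀ i, 0 < b i) :
    Summable fun x : (Fin p → ℤ) × (Fin q → ℤ) => dualTerm lam a b x.1 x.2 := by
  refine Summable.of_norm_bounded ((summable_prod_exp_div ha).mul_of_nonneg
    (summable_prod_exp_div hb) (fun _ => Finset.prod_nonneg fun _ _ => (Real.exp_pos _).le)
    (fun _ => Finset.prod_nonneg fun _ _ => (Real.exp_pos _).le)) fun x => ?_
  unfold dualTerm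
  have : ∀ t : ℝ, ‖Complex.exp (2 * Real.pi * Complex.I * (t : ℂ))‖ = 1 := by
    intro t
    rw [← Complex.norm_exp_ofReal_mul_I (2 * Real.pi * t)]
    congr 2
    push_cast
    ring
  rw [norm_mul, norm_mul, this, mul_one, Complex.norm_real, Complex.norm_real,
    Real.norm_of_nonneg (Finset.prod_nonneg fun _ _ => (Real.exp_pos _).le),
    Real.norm_of_nonneg (Finset.prod_nonneg fun _ _ => (Real.exp_pos _).le)]

theorem tsum_gaussWeight_eq_tsum_dualTerm {p q : ℕ} (lam : Fin q → Fin p → ℝ) {a : Fin p → ℝ}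
    {b : Fin q → ℝ} (ha : ∀ j, 0 < a j) (hb : ∀ i, 0 < b i) :
    ((∑' w, gaussWeight (scaledLattice lam a b w) : ℝ) : ℂ) =
      (∏ i, (b i : ℂ))⁻¹ * ∑' u, ∑' h, dualTerm lam a b u h := by
  have hs := summable_gaussWeight_scaledLattice lam ha hb
  rw [hs.tsum_prod, Complex.ofReal_tsum, ← tsum_mul_left]
  refine tsum_congr fun u => ?_
  set x : Fin q → ℝ := fun i => ∑ j, lam i j * u j with hx
  have h1 : ∀ v : Fin q → ℤ, gaussWeight (scaledLattice lam a b (u, v)) =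
      (∏ j, Real.exp (-(Real.pi * (u j / a j) ^ 2))) *
        ∏ i, Real.exp (-(Real.pi * (b i * (x i - v i)) ^ 2)) := fun v => rfl
  have h2 := (summable_norm_prod_and_tsum_prod
    (fun (i : Fin q) (n : ℤ) => (Real.exp (-(Real.pi * (b i * (x i - n)) ^ 2)) : ℂ)) fun i => by
      refine (summable_gaussian_shift (hb i) (x i)).congr fun n => ?_
      rw [Complex.norm_real, Real.norm_of_nonneg (Real.exp_pos _).le]).2
  have h3 := (summable_norm_prod_and_tsum_prod
    (fun (i : Fin q) (n : ℤ) => (Real.exp (-(Real.pi * (n / b i) ^ 2)) : ℂ) *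
        Complex.exp (2 * Real.pi * Complex.I * (n * x i))) fun i => by
      have hc : 0 < Real.pi / b i ^ 2 := by have := Real.pi_pos; have := hb i; positivity
      refine (summable_exp_neg_mul_int_sq hc).congr fun k => ?_
      have : (2 * Real.pi * Complex.I * (k * x i) : ℂ) =
        ((2 * Real.pi * (k * x i) : ℝ) : ℂ) * Complex.I := by push_cast; ring
      rw [norm_mul, this, Complex.norm_exp_ofReal_mul_I, mul_one, Complex.norm_real,
        Real.norm_of_nonneg (Real.exp_pos _).le]
      congr 1
      ring).2
  rw [tsum_congr h1, tsum_mul_left, Complex.ofReal_mul, Complex.ofReal_tsum]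
  simp only [Complex.ofReal_prod] at h2 ⊢
  rw [h2]
  simp only [← Complex.ofReal_tsum, fun i => poisson_gaussian (hb i) (x i)]
  rw [Finset.prod_mul_distrib, ← h3, Finset.prod_inv_distrib, mul_left_comm, ← tsum_mul_left]
  congr 1
  refine tsum_congr fun h => ?_
  unfold dualTerm
  rw [Finset.prod_mul_distrib, ← Complex.exp_sum, Complex.ofReal_prod, Complex.ofReal_prod,
    ← mul_assoc]
  congr 2
  rw [← Finset.mul_sum]
  congr 1
  push_cast [hx]
  refine Finset.sum_congr rfl fun i _ => ?_
  rw [Finset.mul_sum]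
  exact Finset.sum_congr rfl fun j _ => mul_comm _ _

/-- Poisson summation for the Gaussian over `scaledLattice lam a b` and its dual lattice. -/
theorem tsum_gaussWeight_transpose {p q : ℕ} (lam : Fin q → Fin p → ℝ) {a : Fin p → ℝ}
    {b : Fin q → ℝ} (ha : ∀ j, 0 < a j) (hb : ∀ i, 0 < b i) :
    ∑' w, gaussWeight (scaledLattice lam a b w) =
      (∏ j, a j) / (∏ i, b i) *
        ∑' w, gaussWeight (scaledLattice (fun j i => lam i j) b a w) := by
  have h1 := tsum_gaussWeight_eq_tsum_dualTerm lam ha hb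
  have h2 := tsum_gaussWeight_eq_tsum_dualTerm (fun j i => lam i j) hb ha
  simp only [dualTerm_transpose] at h2
  rw [(summable_dualTerm lam ha hb).tsum_comm] at h2
  have hA : (∏ j, (a j : ℂ)) ≠ 0 :=
    Finset.prod_ne_zero_iff.2 fun j _ => by exact_mod_cast (ha j).ne'
  apply Complex.ofReal_injective
  rw [h1]
  push_cast at h2 ⊢
  rw [h2]
  field_simp

/-- The pairing of `ℝᵖ × ℝ^q` with `ℝ^q × ℝᵖ` under which `scaledLattice lam a b` and its
transpose are dual lattices. -/
noncomputable def crossPairing (p q : ℕ) :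
    (Fin q → ℝ) × (Fin p → ℝ) →ₗ[ℝ] Module.Dual ℝ ((Fin p → ℝ) × (Fin q → ℝ)) :=
  LinearMap.mk₂ ℝ (fun y x => ∑ j, x.1 j * y.2 j - ∑ i, x.2 i * y.1 i)
    (fun y y' x => by simp [mul_add, Finset.sum_add_distrib]; ring)
    (fun c y x => by simp [Finset.mul_sum, mul_sub, mul_left_comm])
    (fun y x x' => by simp [add_mul, Finset.sum_add_distrib]; ring)
    (fun c y x => by simp [Finset.mul_sum, mul_sub, mul_assoc])

theorem crossPairing_apply {p q : ℕ} (y : (Fin q → ℝ) × (Fin p → ℝ))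
    (x : (Fin p → ℝ) × (Fin q → ℝ)) :
    crossPairing p q y x = ∑ j, x.1 j * y.2 j - ∑ i, x.2 i * y.1 i := rfl

theorem crossPairing_injective (p q : ℕ) : Function.Injective (crossPairing p q) := by
  rw [injective_iff_map_eq_zero]
  intro y hy
  ext k
  · have := LinearMap.congr_fun hy (0, Pi.single k 1)
    simpa [crossPairing_apply, Pi.single_apply] using this
  · have := LinearMap.congr_fun hy (Pi.single k 1, 0)
    simpa [crossPairing_apply, Pi.single_apply] using this

theorem abs_crossPairing_le {p q : ℕ} (y : (Fin q → ℝ) × (Fin p → ℝ))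
    (x : (Fin p → ℝ) × (Fin q → ℝ)) : |crossPairing p q y x| ≤ (p + q) * (‖x‖ * ‖y‖) := by
  have key : ∀ {n : ℕ} (s t : Fin n → ℝ), ‖s‖ ≤ ‖x‖ → ‖t‖ ≤ ‖y‖ →
      |∑ j, s j * t j| ≤ n * (‖x‖ * ‖y‖) := by
    intro n s t hs ht
    refine (Finset.abs_sum_le_sum_abs _ _).trans ?_
    refine (Finset.sum_le_card_nsmul _ _ (‖x‖ * ‖y‖) fun j _ => ?_).trans_eq (by simp)
    rw [abs_mul]
    exact mul_le_mul ((norm_le_pi_norm s j).trans hs) ((norm_le_pi_norm t j).trans ht)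
      (abs_nonneg _) (norm_nonneg _)
  rw [crossPairing_apply, add_mul]
  refine (abs_sub _ _).trans ?_
  gcongr
  · exact key _ _ (norm_fst_le x) (norm_snd_le y)
  · exact key _ _ (norm_snd_le x) (norm_fst_le y)

theorem exists_int_crossPairing_eq {p q : ℕ} (lam : Fin q → Fin p → ℝ) {a : Fin p → ℝ}
    {b : Fin q → ℝ} (ha : ∀ j, 0 < a j) (hb : ∀ i, 0 < b i)
    (w : (Fin p → ℤ) × (Fin q → ℤ)) (w' : (Fin q → ℤ) × (Fin p → ℤ)) :
    ∃ m : ℤ, crossPairing p q (scaledLattice (fun j i => lam i j) b a w')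
      (scaledLattice lam a b w) = m := by
  refine ⟨∑ i, w.2 i * w'.1 i - ∑ j, w.1 j * w'.2 j, ?_⟩
  have h1 : ∀ j, (w.1 j : ℝ) / a j * (a j * (∑ i, lam i j * w'.1 i - w'.2 j)) =
      ∑ i, lam i j * w.1 j * w'.1 i - w.1 j * w'.2 j := by
    intro j
    have := (ha j).ne'
    field_simp
    rw [mul_sub, Finset.mul_sum]
    congr 1
    exact Finset.sum_congr rfl fun i _ => by ring
  have h2 : ∀ i, b i * (∑ j, lam i j * w.1 j - w.2 i) * ((w'.1 i : ℝ) / b i) =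
      ∑ j, lam i j * w.1 j * w'.1 i - w.2 i * w'.1 i := by
    intro i
    have := (hb i).ne'
    field_simp
    rw [sub_mul, Finset.sum_mul]
    congr 1
    exact Finset.sum_congr rfl fun j _ => by ring
  rw [crossPairing_apply]
  simp only [scaledLattice, AddMonoidHom.coe_mk, ZeroHom.coe_mk, h1, h2, Finset.sum_sub_distrib]
  rw [Finset.sum_comm]
  push_cast
  ring

open Module in
/-- Short vectors of dual lattices are orthogonal, so the dimensions of their spans add up to at
most the dimension of the space. -/
theorem finrank_span_add_finrank_span_le {p q : ℕ} (lam : Fin q → Fin p → ℝ) {a : Fin p → ℝ}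
    {b : Fin q → ℝ} (ha : ∀ j, 0 < a j) (hb : ∀ i, 0 < b i) {Z Y : ℝ} (hZ : 0 ≤ Z)
    (hY : (p + q) * (Z * Y) < 1) :
    finrank ℝ (Submodule.span ℝ {x | ∃ w, ‖scaledLattice lam a b w‖ ≤ Z ∧
        scaledLattice lam a b w = x}) +
      finrank ℝ (Submodule.span ℝ {y | ∃ w, ‖scaledLattice (fun j i => lam i j) b a w‖ ≤ Y ∧
        scaledLattice (fun j i => lam i j) b a w = y}) ≤ p + q := by
  set V := Submodule.span ℝ {x | ∃ w, ‖scaledLattice lam a b w‖ ≤ Z ∧ scaledLattice lam a b w = x}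
  set W := Submodule.span ℝ {y | ∃ w, ‖scaledLattice (fun j i => lam i j) b a w‖ ≤ Y ∧
    scaledLattice (fun j i => lam i j) b a w = y}
  have hWV : W.map (crossPairing p q) ≤ V.dualAnnihilator := by
    rw [Submodule.map_span_le]
    rintro _ ⟨w', hw', rfl⟩
    rw [Submodule.mem_dualAnnihilator]
    intro x hx
    induction hx using Submodule.span_induction with
    | mem x hx =>
      obtain ⟨w, hw, rfl⟩ := hx
      obtain ⟨m, hm⟩ := exists_int_crossPairing_eq lam ha hb w w'
      have h1 := abs_crossPairing_le (scaledLattice (fun j i => lam i j) b a w')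
        (scaledLattice lam a b w)
      have h2 : |(m : ℝ)| < 1 := by
        rw [← hm]
        refine (h1.trans ?_).trans_lt hY
        gcongr
      have h3 : m = 0 := by
        rw [← Int.cast_abs] at h2
        exact Int.abs_lt_one_iff.1 (by exact_mod_cast h2)
      rw [hm, h3, Int.cast_zero]
    | zero => simp
    | add x y _ _ hx hy => rw [map_add, hx, hy, add_zero]
    | smul c x _ hx => rw [map_smul, hx, smul_zero]
  have h1 := Submodule.finrank_mono hWV
  rw [← (W.equivMapOfInjective _ (crossPairing_injective p q)).finrank_eq] at h1
  have h2 := Subspace.finrank_add_finrank_dualAnnihilator_eq V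
  rw [finrank_prod, finrank_fin_fun, finrank_fin_fun] at h2
  omega

/-- If the lattice points of norm at most `Z` span a space of dimension at most `m`, the count
grows at most like the `m`-th power of the radius. -/
theorem latticeCount_le_pow_mul {p q m : ℕ} (lam : Fin q → Fin p → ℝ) {a : Fin p → ℝ}
    {b : Fin q → ℝ} (ha : ∀ j, 0 < a j) (hb : ∀ i, 0 < b i) {r Z : ℝ} (hr : 0 < r) (hZ : 0 ≤ Z)
    (hm : Module.finrank ℝ (Submodule.span ℝ {x | ∃ w, ‖scaledLattice lam a b w‖ ≤ Z ∧
        scaledLattice lam a b w = x}) ≤ m) :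
    (latticeCount q p lam a b Z : ℝ) ≤ (1 + 2 * Z / r) ^ m * latticeCount q p lam a b r := by
  have hfin := finite_norm_scaledLattice_le lam ha hb hZ
  rw [latticeCount_eq_ncard lam ha hb hZ, Set.ncard_eq_toFinset_card _ hfin]
  refine (card_le_mul_of_mem_submodule (scaledLattice lam a b) _ hZ hr _
    (card_le_latticeCount lam ha hb hr.le) hfin.toFinset fun w hw => ?_).trans
    (mul_le_mul_of_nonneg_right (pow_le_pow_right₀ ?_ hm) (Nat.cast_nonneg _))
  · have hw' : ‖scaledLattice lam a b w‖ ≤ Z := by simpa using hw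
    exact ⟨Submodule.subset_span ⟨w, hw', rfl⟩, hw'⟩
  · have : 0 ≤ 2 * Z / r := by positivity
    linarith

/-- Transference: the number of points of a lattice in a box of radius `Z` is bounded in terms of
the number of points of the dual lattice in the box of radius `c / Z`. -/
theorem exists_latticeCount_le_transpose (p q : ℕ) {c : ℝ} (hc : 0 < c) :
    ∃ C : ℝ, 0 < C ∧ ∀ (lam : Fin q → Fin p → ℝ) (a : Fin p → ℝ) (b : Fin q → ℝ),
      (∀ j, 0 < a j) → (∀ i, 0 < b i) → ∀ Z : ℝ, 0 < Z →
        (latticeCount q p lam a b Z : ℝ) ≤ C * (Z ^ (p + q) * ((∏ j, a j) / ∏ i, b i) *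
          latticeCount p q (fun j i => lam i j) b a (c / Z)) := by
  obtain ⟨C, hC0, hC⟩ := exists_sum_gaussWeight_le q p hc
  set ε := Real.exp (-Real.pi) ^ (p + q)
  have hε0 : 0 < ε := by positivity
  refine ⟨C / ε, by positivity, fun lam a b ha hb Z hZ => ?_⟩
  have ha' : ∀ j, 0 < a j * Z := fun j => mul_pos (ha j) hZ
  have hb' : ∀ i, 0 < b i / Z := fun i => div_pos (hb i) hZ
  have hdual : ∑' w, gaussWeight (scaledLattice (fun j i => lam i j) (fun i => b i / Z)
      (fun j => a j * Z) w) ≤ C * latticeCount p q (fun j i => lam i j) b a (c / Z) := by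
    refine (summable_gaussWeight_scaledLattice _ hb' ha').tsum_le_of_sum_le (hC _ _ fun t ht => ?_)
    refine card_le_latticeCount _ hb ha (by positivity) t fun w hw => ?_
    have h1 := scaledLattice_rescale (fun j i => lam i j) b a (inv_pos.2 hZ) w
    simp only [← div_eq_mul_inv, div_inv_eq_mul] at h1
    rw [le_div_iff₀ hZ, ← h1]
    exact ht w hw
  have hprimal : ε * latticeCount q p lam a b Z ≤
      ∑' w, gaussWeight (scaledLattice lam (fun j => a j * Z) (fun i => b i / Z) w) := by
    have hfin := finite_norm_scaledLattice_le lam ha hb hZ.le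
    rw [latticeCount_eq_ncard lam ha hb hZ.le, Set.ncard_eq_toFinset_card _ hfin, mul_comm,
      ← nsmul_eq_mul]
    refine (Finset.card_nsmul_le_sum hfin.toFinset _ ε fun w hw => ?_).trans
      ((summable_gaussWeight_scaledLattice lam ha' hb').sum_le_tsum _
        fun w _ => (gaussWeight_pos _).le)
    refine exp_neg_le_gaussWeight ?_
    rw [scaledLattice_rescale lam a b hZ, div_le_one hZ]
    simpa using hw
  rw [tsum_gaussWeight_transpose lam ha' hb'] at hprimal
  have hdet : (∏ j, a j * Z) / (∏ i, b i / Z) = Z ^ (p + q) * ((∏ j, a j) / ∏ i, b i) := by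
    rw [Finset.prod_mul_distrib, Finset.prod_div_distrib, Fin.prod_const, Fin.prod_const, pow_add]
    field_simp
  rw [hdet] at hprimal
  have hD : 0 ≤ Z ^ (p + q) * ((∏ j, a j) / ∏ i, b i) :=
    mul_nonneg (by positivity) (div_nonneg (Finset.prod_nonneg fun j _ => (ha j).le)
      (Finset.prod_nonneg fun i _ => (hb i).le))
  have := hprimal.trans (mul_le_mul_of_nonneg_left hdual hD)
  rw [div_mul_eq_mul_div, le_div_iff₀ hε0]
  linarith

theorem statement8 (n₁ n₂ : ℕ) (hn₁ : 0 < n₁) (hn₂ : 0 < n₂) :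
    ∃ Cc : ℝ, 0 < Cc ∧
      ∀ (lam : Fin n₁ → Fin n₂ → ℝ) (a : Fin n₂ → ℝ) (b : Fin n₁ → ℝ),
        (∀ j, 1 < a j) → (∀ i, 1 < b i) →
        ∀ Z₁ Z₂ : ℝ, 0 < Z₁ → Z₁ ≤ Z₂ → Z₂ ≤ 1 →
          (latticeCount n₁ n₂ lam a b Z₂ : ℝ) ≤
            Cc * max
              ((Z₂ / Z₁) ^ n₂ * (latticeCount n₁ n₂ lam a b Z₁ : ℝ))
              ((Z₂ ^ n₂ / Z₁ ^ n₁) * ((∏ j, a j) / ∏ i, b i) *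
                (latticeCount n₂ n₁ (fun j i => lam i j) b a Z₁ : ℝ)) := by
  have hN : 0 < (n₂ : ℝ) + n₁ := by positivity
  have hN1 : (1 : ℝ) ≤ n₂ + n₁ := by exact_mod_cast Nat.succ_le_of_lt (Nat.add_pos_left hn₂ n₁)
  set c : ℝ := 1 / (2 * (n₂ + n₁)) with hc
  have hc0 : 0 < c := by positivity
  have hc1 : c ≤ 1 := by rw [hc, div_le_one (by positivity)]; linarith
  obtain ⟨C, hC0, hC⟩ := exists_latticeCount_le_transpose n₂ n₁ hc0
  refine ⟨max (3 ^ n₂) (C * 3 ^ n₁), by positivity, ?_⟩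
  intro lam a b ha hb Z₁ Z₂ hZ₁ hZ hZ₂
  have ha0 : ∀ j, 0 < a j := fun j => one_pos.trans (ha j)
  have hb0 : ∀ i, 0 < b i := fun i => one_pos.trans (hb i)
  have hZ₂0 : 0 < Z₂ := hZ₁.trans_le hZ
  set D := (∏ j, a j) / ∏ i, b i
  have hD : 0 ≤ D := div_nonneg (Finset.prod_nonneg fun j _ => (ha0 j).le)
    (Finset.prod_nonneg fun i _ => (hb0 i).le)
  have hYZ : ((n₂ : ℝ) + n₁) * (Z₂ * (c / Z₂)) < 1 := by
    have : ((n₂ : ℝ) + n₁) * (Z₂ * (c / Z₂)) = 1 / 2 := by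
      rw [hc]; field_simp
    rw [this]; norm_num
  have hrank := finrank_span_add_finrank_span_le lam ha0 hb0 hZ₂0.le hYZ
  rcases Nat.le_total (Module.finrank ℝ (Submodule.span ℝ {x | ∃ w,
      ‖scaledLattice lam a b w‖ ≤ Z₂ ∧ scaledLattice lam a b w = x})) n₂ with h | h
  · have hgrow := latticeCount_le_pow_mul lam ha0 hb0 hZ₁ hZ₂0.le h
    have h1 : 1 + 2 * Z₂ / Z₁ ≤ 3 * (Z₂ / Z₁) := by
      have : 1 ≤ Z₂ / Z₁ := (one_le_div hZ₁).2 hZ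
      rw [mul_div_assoc]
      linarith
    calc (latticeCount n₁ n₂ lam a b Z₂ : ℝ)
        ≤ (3 * (Z₂ / Z₁)) ^ n₂ * latticeCount n₁ n₂ lam a b Z₁ := by
          refine hgrow.trans ?_
          gcongr
      _ = 3 ^ n₂ * ((Z₂ / Z₁) ^ n₂ * latticeCount n₁ n₂ lam a b Z₁) := by
          rw [mul_pow, mul_assoc]
      _ ≤ _ := mul_le_mul (le_max_left _ _) (le_max_left _ _) (by positivity) (by positivity)
  · have hgrow := latticeCount_le_pow_mul (m := n₁) (fun j i => lam i j) hb0 ha0 hZ₁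
      (div_pos hc0 hZ₂0).le (by omega)
    have h1 : 1 + 2 * (c / Z₂) / Z₁ ≤ 3 / (Z₂ * Z₁) := by
      rw [mul_div_assoc, div_div, ← mul_div_assoc, le_div_iff₀ (by positivity), add_mul,
        div_mul_cancel₀ _ (by positivity)]
      have : Z₂ * Z₁ ≤ 1 := mul_le_one₀ hZ₂ hZ₁.le (hZ.trans hZ₂)
      linarith
    calc (latticeCount n₁ n₂ lam a b Z₂ : ℝ)
        ≤ C * (Z₂ ^ (n₂ + n₁) * D *
            ((3 / (Z₂ * Z₁)) ^ n₁ * latticeCount n₂ n₁ (fun j i => lam i j) b a Z₁)) := by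
          refine (hC lam a b ha0 hb0 Z₂ hZ₂0).trans ?_
          refine mul_le_mul_of_nonneg_left (mul_le_mul_of_nonneg_left ?_ (by positivity)) hC0.le
          refine hgrow.trans ?_
          gcongr
      _ = C * 3 ^ n₁ * ((Z₂ ^ n₂ / Z₁ ^ n₁) * D *
            latticeCount n₂ n₁ (fun j i => lam i j) b a Z₁) := by
          rw [div_pow, mul_pow, pow_add]
          field_simp
      _ ≤ _ := mul_le_mul (le_max_right _ _) (le_max_right _ _) (by positivity) (by positivity)
end

section
/- Let n be a positive integer and (λ_{i,j})_{1≤i,j≤n} real numbers with λ_{i,j} = λ_{j,i} for all i, j, and define the linear forms L_i(u₁,…,u_n) := ∑_{j=1}^{n} λ_{i,j}u_j. Let a₁,…,a_n > 1 be reals, and for 0 ≤ Z ≤ 1 set U(Z) := #{(u₁,…,u_{2n}) ∈ ℤ^{2n} : |u_j| ≤ a_j·Z for all 1 ≤ j ≤ n and |L_i(u₁,…,u_n) − u_{n+i}| ≤ a_i^{−1}·Z for all 1 ≤ i ≤ n}. Then for all 0 < Z₁ ≤ Z₂ ≤ 1: U(Z₂) ≪_n (Z₂/Z₁)^n·U(Z₁),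 where the implied constant depends only on n. -/
/-!
Statement 9 (symmetric case of the geometry-of-numbers lemma): for a positive
integer `n`, symmetric real coefficients `λ_{i,j} = λ_{j,i}`, linear forms
`L_i(u) = ∑_j λ_{i,j} u_j`, reals `a₁,…,a_n > 1`, and
`U(Z) = #{(u₁,…,u_{2n}) ∈ ℤ^{2n} : |u_j| ≤ a_j Z (j ≤ n), |L_i(u₁,…,u_n) - u_{n+i}| ≤ a_i⁻¹ Z}`,
one has `U(Z₂) ≪_n (Z₂/Z₁)^n U(Z₁)` for all `0 < Z₁ ≤ Z₂ ≤ 1`.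
-/

open scoped BigOperators

/-- The counting function `U(Z)`. -/
noncomputable def symLatticeCount (n : ℕ) (lam : Fin n → Fin n → ℝ)
    (a : Fin n → ℝ) (Z : ℝ) : ℕ :=
  Set.ncard {u : (Fin n → ℤ) × (Fin n → ℤ) |
    (∀ j, |(u.1 j : ℝ)| ≤ a j * Z) ∧
    (∀ i, |(∑ j, lam i j * (u.1 j : ℝ)) - (u.2 i : ℝ)| ≤ (a i)⁻¹ * Z)}

/-- A set of group elements whose images lie in a `d`-dimensional subspace and have norm at most `R`
can be covered by few translates of the set of elements whose images have norm at most `r`. -/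
theorem ncard_le_of_mem_submodule {G E : Type*} [AddCommGroup G] [NormedAddCommGroup E]
    [InnerProductSpace ℝ E] [FiniteDimensional ℝ E] (φ : G →+ E) (V : Submodule ℝ E)
    {S : Set G} {r R : ℝ} (hr : 0 < r) (hrR : r ≤ R) (hSV : ∀ s ∈ S, φ s ∈ V)
    (hSR : ∀ s ∈ S, ‖φ s‖ ≤ R) (hfin : {g | ‖φ g‖ ≤ r}.Finite) :
    (S.ncard : ℝ) ≤ (5 * (Module.finrank ℝ V + 1) * (R / r)) ^ Module.finrank ℝ V *
      ({g | ‖φ g‖ ≤ r}.ncard : ℝ) := by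
  classical
  rcases S.finite_or_infinite with hS | hS
  swap
  · rw [hS.ncard]
    have : 0 ≤ R / r := by have := hr.le.trans hrR; positivity
    push_cast
    positivity
  lift S to Finset G using hS
  set d := Module.finrank ℝ V with hd
  set b := stdOrthonormalBasis ℝ V
  set K : ℝ := (d + 1) * (R / r) with hK
  have hRr : 1 ≤ R / r := (one_le_div hr).2 hrR
  have hK1 : 1 ≤ K := by
    have : (0 : ℝ) ≤ d := d.cast_nonneg
    nlinarith
  set m : ℕ := ⌈K⌉₊
  let f : G → Fin d → ℤ := fun g i ↦ ⌊inner ℝ (b i : E) (φ g) * ((d + 1) / r)⌋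
  have hmaps : ∀ s ∈ S, f s ∈ Fintype.piFinset fun _ : Fin d ↦ Finset.Icc (-(m : ℤ)) m := by
    intro s hs
    rw [Fintype.mem_piFinset]
    intro i
    have h1 : |inner ℝ (b i : E) (φ s)| ≤ R := by
      refine (abs_real_inner_le_norm _ _).trans ?_
      have : ‖(b i : E)‖ = 1 := b.orthonormal.1 i
      rw [this, one_mul]
      exact hSR s hs
    have h2 : |inner ℝ (b i : E) (φ s) * ((d + 1) / r)| ≤ m := by
      rw [abs_mul, abs_of_pos (show (0 : ℝ) < (d + 1) / r by positivity)]
      calc _ ≤ R * ((d + 1) / r) := by gcongr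
        _ = K := by rw [hK]; ring
        _ ≤ m := Nat.le_ceil K
    rw [abs_le] at h2
    rw [Finset.mem_Icc]
    refine ⟨Int.le_floor.2 ?_, ?_⟩
    · push_cast
      exact h2.1
    · have h3 : (f s i : ℝ) ≤ m := (Int.floor_le _).trans h2.2
      exact_mod_cast h3
  have hfib : ∀ z ∈ Fintype.piFinset fun _ : Fin d ↦ Finset.Icc (-(m : ℤ)) m,
      (S.filter fun s ↦ f s = z).card ≤ {g | ‖φ g‖ ≤ r}.ncard := by
    intro z _
    rcases (S.filter fun s ↦ f s = z).eq_empty_or_nonempty with h0 | ⟨t, ht⟩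
    · simp [h0]
    rw [← Set.ncard_coe_finset]
    refine Set.ncard_le_ncard_of_injOn (fun s ↦ s - t) ?_ (sub_left_injective.injOn) hfin
    intro s hs
    simp only [Finset.coe_filter, Finset.mem_filter, Set.mem_ofPred_eq] at hs ht ⊢
    have hmem : φ (s - t) ∈ V := by
      rw [map_sub]
      exact V.sub_mem (hSV s hs.1) (hSV t ht.1)
    have hsum : φ (s - t) = ∑ i, inner ℝ (b i : E) (φ (s - t)) • (b i : E) := by
      have := congrArg (Subtype.val) (b.sum_repr' ⟨φ (s - t), hmem⟩)
      simpa using this.symm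
    have hcoord : ∀ i, |inner ℝ (b i : E) (φ (s - t))| ≤ r / (d + 1) := by
      intro i
      have hfl : f s i = f t i := by rw [hs.2, ht.2]
      have h1 := (Int.abs_sub_lt_one_of_floor_eq_floor hfl).le
      rw [← sub_mul, ← inner_sub_right, ← map_sub, abs_mul,
        abs_of_pos (show (0 : ℝ) < (d + 1) / r by positivity), ← le_div_iff₀ (by positivity)] at h1
      simpa using h1
    calc ‖φ (s - t)‖ = ‖∑ i, inner ℝ (b i : E) (φ (s - t)) • (b i : E)‖ := by rw [← hsum]
      _ ≤ ∑ i, ‖inner ℝ (b i : E) (φ (s - t)) • (b i : E)‖ := norm_sum_le _ _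
      _ ≤ ∑ _i : Fin d, r / (d + 1) := by
        refine Finset.sum_le_sum fun i _ ↦ ?_
        have : ‖(b i : E)‖ = 1 := b.orthonormal.1 i
        rw [norm_smul, this, mul_one]
        exact hcoord i
      _ ≤ r := by
        rw [Finset.sum_const, Finset.card_univ, Fintype.card_fin, nsmul_eq_mul, ← mul_div_assoc,
          div_le_iff₀ (by positivity)]
        nlinarith
  have hcard := Finset.card_le_mul_card_image_of_maps_to hmaps _ hfib
  rw [Fintype.card_piFinset_const, Int.card_Icc] at hcard
  rw [Set.ncard_coe_finset, mul_comm]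
  calc (S.card : ℝ) ≤ ({g | ‖φ g‖ ≤ r}.ncard : ℝ) * ((2 * m + 1 : ℕ) : ℝ) ^ d := by
        have : ((m : ℤ) + 1 - -(m : ℤ)).toNat = 2 * m + 1 := by omega
        rw [this] at hcard
        exact_mod_cast hcard
    _ ≤ _ := by
        gcongr
        have : (m : ℝ) < K + 1 := Nat.ceil_lt_add_one (by positivity)
        push_cast
        rw [mul_assoc, ← hK]
        linarith

/-- The standard complex structure on `ℝⁿ × ℝⁿ`. -/
noncomputable def euclideanComplexStructure (n : ℕ) :
    EuclideanSpace ℝ (Fin n ⊕ Fin n) →ₗ[ℝ] EuclideanSpace ℝ (Fin n ⊕ Fin n) where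
  toFun x := WithLp.toLp 2 (Sum.elim (fun i ↦ -x (.inr i)) (fun i ↦ x (.inl i)))
  map_add' x y := by
    ext (i | i) <;> simp [add_comm]
  map_smul' c x := by
    ext (i | i) <;> simp

theorem euclideanComplexStructure_injective (n : ℕ) :
    Function.Injective (euclideanComplexStructure n) := by
  rw [injective_iff_map_eq_zero]
  intro x hx
  ext (i | i)
  · simpa [euclideanComplexStructure] using congrArg (fun y ↦ y (.inr i)) hx
  · simpa [euclideanComplexStructure] using congrArg (fun y ↦ y (.inl i)) hx

theorem inner_euclideanComplexStructure {n : ℕ} (x y : EuclideanSpace ℝ (Fin n ⊕ Fin n)) :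
    inner ℝ (euclideanComplexStructure n x) y =
      ∑ i, (x (.inl i) * y (.inr i) - x (.inr i) * y (.inl i)) := by
  simp [euclideanComplexStructure, PiLp.inner_apply, Finset.sum_sub_distrib, mul_comm]
  ring

/-- The span of a set on which the standard symplectic form vanishes has dimension at most `n`. -/
theorem finrank_span_le_of_isotropic {n : ℕ} {T : Set (EuclideanSpace ℝ (Fin n ⊕ Fin n))}
    (hT : ∀ x ∈ T, ∀ y ∈ T, inner ℝ (euclideanComplexStructure n x) y = 0) :
    Module.finrank ℝ (Submodule.span ℝ T) ≤ n := by
  set V := Submodule.span ℝ T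
  have hle : V.map (euclideanComplexStructure n) ≤ Vᗮ := by
    rw [Submodule.map_le_iff_le_comap, Submodule.span_le]
    intro x hx
    rw [SetLike.mem_coe, Submodule.mem_comap, Submodule.mem_orthogonal']
    intro y hy
    induction hy using Submodule.span_induction with
    | mem y hy => exact hT x hx y hy
    | zero => exact inner_zero_right _
    | add y z _ _ hy hz => rw [inner_add_right, hy, hz, add_zero]
    | smul c y _ hy => rw [inner_smul_right, hy, mul_zero]
  have h1 := Submodule.finrank_mono hle
  have h2 := V.finrank_add_finrank_orthogonal
  rw [← (Submodule.equivMapOfInjective _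
    (euclideanComplexStructure_injective n) V).finrank_eq] at h1
  rw [finrank_euclideanSpace, Fintype.card_sum, Fintype.card_fin] at h2
  omega

/-- The embedding of `ℤ²ⁿ` as a lattice for which `symLatticeCount` counts points in cubes. -/
noncomputable def symLatticeHom (n : ℕ) (lam : Fin n → Fin n → ℝ) (a : Fin n → ℝ) :
    (Fin n → ℤ) × (Fin n → ℤ) →+ EuclideanSpace ℝ (Fin n ⊕ Fin n) where
  toFun u := WithLp.toLp 2 (Sum.elim (fun j ↦ (u.1 j : ℝ) / a j)
    (fun i ↦ a i * ((∑ j, lam i j * (u.1 j : ℝ)) - (u.2 i : ℝ))))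
  map_zero' := by
    ext (i | i) <;> simp
  map_add' u v := by
    ext (i | i)
    · simp [add_div]
    · simp [mul_add, Finset.sum_add_distrib]
      ring

section

variable {n : ℕ} {lam : Fin n → Fin n → ℝ} {a : Fin n → ℝ}

theorem abs_symLatticeHom_le_iff (ha : ∀ j, 0 < a j) (u : (Fin n → ℤ) × (Fin n → ℤ)) (Z : ℝ) :
    (∀ k, |symLatticeHom n lam a u k| ≤ Z) ↔
      (∀ j, |(u.1 j : ℝ)| ≤ a j * Z) ∧
      (∀ i, |(∑ j, lam i j * (u.1 j : ℝ)) - (u.2 i : ℝ)| ≤ (a i)⁻¹ * Z) := by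
  rw [Sum.forall]
  refine and_congr (forall_congr' fun j ↦ ?_) (forall_congr' fun i ↦ ?_)
  · simp only [symLatticeHom, AddMonoidHom.coe_mk, ZeroHom.coe_mk, Sum.elim_inl]
    rw [abs_div, abs_of_pos (ha j), div_le_iff₀' (ha j)]
  · simp only [symLatticeHom, AddMonoidHom.coe_mk, ZeroHom.coe_mk, Sum.elim_inr]
    rw [abs_mul, abs_of_pos (ha i), inv_mul_eq_div, le_div_iff₀' (ha i)]

theorem symLatticeCount_eq (ha : ∀ j, 0 < a j) (Z : ℝ) :
    symLatticeCount n lam a Z = {u | ∀ k, |symLatticeHom n lam a u k| ≤ Z}.ncard := by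
  simp only [symLatticeCount, abs_symLatticeHom_le_iff ha]

theorem finite_abs_symLatticeHom_le (ha : ∀ j, 0 < a j) (Z : ℝ) :
    {u | ∀ k, |symLatticeHom n lam a u k| ≤ Z}.Finite := by
  have hfin : ∀ (c : Fin n → ℝ) (B : Fin n → ℝ),
      {v : Fin n → ℤ | ∀ i, |c i - (v i : ℝ)| ≤ B i}.Finite := by
    intro c B
    refine (Set.finite_Icc (fun i ↦ ⌊c i - B i⌋) (fun i ↦ ⌈c i + B i⌉)).subset fun v hv ↦ ?_
    refine ⟨fun i ↦ ?_, fun i ↦ ?_⟩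
    · have := abs_le.1 (hv i)
      exact_mod_cast (Int.floor_le (c i - B i)).trans (by linarith : _ ≤ (v i : ℝ))
    · have := abs_le.1 (hv i)
      exact_mod_cast (by linarith : (v i : ℝ) ≤ _).trans (Int.le_ceil (c i + B i))
  simp only [abs_symLatticeHom_le_iff ha]
  refine ((hfin 0 fun j ↦ a j * Z).biUnion fun v _ ↦ (Set.finite_singleton v).prod
    (hfin (fun i ↦ ∑ j, lam i j * (v j : ℝ)) fun i ↦ (a i)⁻¹ * Z)).subset fun u hu ↦ ?_
  simp only [Set.mem_iUnion]
  exact ⟨u.1, by simpa using hu.1, rfl, hu.2⟩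

/-- The standard symplectic form is integral on the lattice. -/
theorem exists_int_inner_symLatticeHom (hlam : ∀ i j, lam i j = lam j i) (ha : ∀ j, 0 < a j)
    (u v : (Fin n → ℤ) × (Fin n → ℤ)) :
    ∃ z : ℤ, inner ℝ (euclideanComplexStructure n (symLatticeHom n lam a u))
      (symLatticeHom n lam a v) = z := by
  refine ⟨∑ i, (u.2 i * v.1 i - u.1 i * v.2 i), ?_⟩
  have hterm : ∀ i, symLatticeHom n lam a u (.inl i) * symLatticeHom n lam a v (.inr i) -
      symLatticeHom n lam a u (.inr i) * symLatticeHom n lam a v (.inl i) =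
      (∑ j, lam i j * (u.1 i * v.1 j) - ∑ j, lam i j * (u.1 j * v.1 i)) +
        (u.2 i * v.1 i - u.1 i * v.2 i : ℝ) := by
    intro i
    have := (ha i).ne'
    have h1 : ∑ j, lam i j * ((u.1 i : ℝ) * v.1 j) = u.1 i * ∑ j, lam i j * v.1 j := by
      rw [Finset.mul_sum]
      exact Finset.sum_congr rfl fun j _ ↦ by ring
    have h2 : ∑ j, lam i j * ((u.1 j : ℝ) * v.1 i) = (∑ j, lam i j * u.1 j) * v.1 i := by
      rw [Finset.sum_mul]
      exact Finset.sum_congr rfl fun j _ ↦ by ring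
    rw [h1, h2]
    simp only [symLatticeHom, AddMonoidHom.coe_mk, ZeroHom.coe_mk, Sum.elim_inl, Sum.elim_inr]
    field_simp
    ring
  have hsymm : ∑ i, ∑ j, lam i j * ((u.1 j : ℝ) * v.1 i) =
      ∑ i, ∑ j, lam i j * ((u.1 i : ℝ) * v.1 j) := by
    rw [Finset.sum_comm]
    exact Finset.sum_congr rfl fun i _ ↦ Finset.sum_congr rfl fun j _ ↦ by rw [hlam]
  rw [inner_euclideanComplexStructure, Finset.sum_congr rfl fun i _ ↦ hterm i,
    Finset.sum_add_distrib, Finset.sum_sub_distrib, hsymm, sub_self, zero_add]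
  push_cast
  rfl

/-- If the lattice points in a cube of side `2R` lie in a subspace of dimension at most `d`, then
their number shrinks at most like the `d`-th power of the side. -/
theorem symLatticeCount_le_of_mem_submodule (hn : 0 < n) (ha : ∀ j, 0 < a j) {r R : ℝ}
    (hr : 0 < r) (hrR : r ≤ R) (V : Submodule ℝ (EuclideanSpace ℝ (Fin n ⊕ Fin n))) {d : ℕ}
    (hV : Module.finrank ℝ V ≤ d)
    (hmem : ∀ u, (∀ k, |symLatticeHom n lam a u k| ≤ R) → symLatticeHom n lam a u ∈ V) :
    (symLatticeCount n lam a R : ℝ) ≤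
      (10 * n * (d + 1) * (R / r)) ^ d * (symLatticeCount n lam a r : ℝ) := by
  have hn1 : (1 : ℝ) ≤ n := by exact_mod_cast hn
  have hsub : {u | ‖symLatticeHom n lam a u‖ ≤ r} ⊆
      {u | ∀ k, |symLatticeHom n lam a u k| ≤ r} := fun u hu k ↦
    (PiLp.norm_apply_le (symLatticeHom n lam a u) k).trans hu
  have hfin := finite_abs_symLatticeHom_le (lam := lam) ha r
  have hR : 0 < R := hr.trans_le hrR
  have hnorm : ∀ u ∈ {u | ∀ k, |symLatticeHom n lam a u k| ≤ R},
      ‖symLatticeHom n lam a u‖ ≤ 2 * n * R := by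
    intro u hu
    rw [EuclideanSpace.norm_eq, Real.sqrt_le_left (by positivity)]
    calc ∑ k, ‖symLatticeHom n lam a u k‖ ^ 2 ≤ ∑ _k : Fin n ⊕ Fin n, R ^ 2 := by
          gcongr with k
          exact hu k
      _ = (2 * n) * R ^ 2 := by simp [two_mul]
      _ ≤ (2 * n * R) ^ 2 := by
          have : 0 ≤ n * R ^ 2 := by positivity
          nlinarith
  have key := ncard_le_of_mem_submodule (symLatticeHom n lam a) V hr
    (R := 2 * n * R) (by nlinarith) hmem hnorm (hfin.subset hsub)
  rw [symLatticeCount_eq ha, symLatticeCount_eq ha]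
  refine key.trans ?_
  have hRr : 1 ≤ R / r := (one_le_div hr).2 hrR
  have hd : (Module.finrank ℝ V : ℝ) ≤ d := by exact_mod_cast hV
  have hle : 5 * (Module.finrank ℝ V + 1) * (2 * n * R / r) ≤ 10 * n * (d + 1) * (R / r) := by
    calc _ ≤ 5 * (d + 1) * (2 * n * R / r) := by gcongr
      _ = _ := by ring
  have hone : 1 ≤ 10 * n * (d + 1) * (R / r) := by
    have : (0 : ℝ) ≤ d := d.cast_nonneg
    refine one_le_mul_of_one_le_of_one_le ?_ hRr
    nlinarith
  gcongr ?_ * ?_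
  · exact (pow_le_pow_left₀ (by positivity) hle _).trans (pow_le_pow_right₀ hone hV)
  · exact_mod_cast Set.ncard_le_ncard hsub hfin

theorem symLatticeCount_le_pow_two_mul (hn : 0 < n) (ha : ∀ j, 0 < a j) {r R : ℝ}
    (hr : 0 < r) (hrR : r ≤ R) :
    (symLatticeCount n lam a R : ℝ) ≤
      (10 * n * (2 * n + 1) * (R / r)) ^ (2 * n) * (symLatticeCount n lam a r : ℝ) := by
  have hV : Module.finrank ℝ (⊤ : Submodule ℝ (EuclideanSpace ℝ (Fin n ⊕ Fin n))) ≤ 2 * n := by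
    rw [finrank_top, finrank_euclideanSpace, Fintype.card_sum, Fintype.card_fin, two_mul]
  exact_mod_cast symLatticeCount_le_of_mem_submodule hn ha hr hrR ⊤ hV fun _ _ ↦ Submodule.mem_top

theorem symLatticeCount_le_pow (hn : 0 < n) (hlam : ∀ i j, lam i j = lam j i)
    (ha : ∀ j, 0 < a j) {r R : ℝ} (hr : 0 < r) (hrR : r ≤ R) (hR : R ≤ 1 / (2 * n)) :
    (symLatticeCount n lam a R : ℝ) ≤
      (10 * n * (n + 1) * (R / r)) ^ n * (symLatticeCount n lam a r : ℝ) := by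
  have hn1 : (1 : ℝ) ≤ n := by exact_mod_cast hn
  have hR0 : 0 < R := hr.trans_le hrR
  refine symLatticeCount_le_of_mem_submodule hn ha hr hrR
    (Submodule.span ℝ (symLatticeHom n lam a '' {u | ∀ k, |symLatticeHom n lam a u k| ≤ R}))
    (finrank_span_le_of_isotropic ?_) fun u hu ↦ Submodule.subset_span ⟨u, hu, rfl⟩
  rintro _ ⟨u, hu, rfl⟩ _ ⟨v, hv, rfl⟩
  obtain ⟨z, hz⟩ := exists_int_inner_symLatticeHom hlam ha u v
  have hlt : |(z : ℝ)| < 1 := by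
    rw [← hz, inner_euclideanComplexStructure]
    calc _ ≤ ∑ i, |symLatticeHom n lam a u (.inl i) * symLatticeHom n lam a v (.inr i) -
          symLatticeHom n lam a u (.inr i) * symLatticeHom n lam a v (.inl i)| :=
          Finset.abs_sum_le_sum_abs _ _
      _ ≤ ∑ _i : Fin n, 2 * (R * R) := by
          refine Finset.sum_le_sum fun i _ ↦ (abs_sub _ _).trans ?_
          rw [abs_mul, abs_mul, two_mul]
          gcongr
          exacts [hu _, hv _, hu _, hv _]
      _ = 2 * n * R * R := by simp; ring
      _ ≤ 1 * R := by
          gcongr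
          rwa [le_div_iff₀' (by positivity)] at hR
      _ < 1 := by
          rw [one_mul]
          refine hR.trans_lt ?_
          rw [div_lt_one (by positivity)]
          linarith
  have : z = 0 := Int.abs_lt_one_iff.1 (by exact_mod_cast hlt)
  rw [hz, this, Int.cast_zero]

theorem symLatticeCount_mono (ha : ∀ j, 0 < a j) {r R : ℝ} (hrR : r ≤ R) :
    symLatticeCount n lam a r ≤ symLatticeCount n lam a R := by
  rw [symLatticeCount_eq ha, symLatticeCount_eq ha]
  exact Set.ncard_le_ncard (fun u hu k ↦ (hu k).trans hrR) (finite_abs_symLatticeHom_le ha R)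

end

theorem statement9 (n : ℕ) (hn : 0 < n) :
    ∃ Cc : ℝ, 0 < Cc ∧
      ∀ (lam : Fin n → Fin n → ℝ), (∀ i j, lam i j = lam j i) →
      ∀ (a : Fin n → ℝ), (∀ j, 1 < a j) →
      ∀ Z₁ Z₂ : ℝ, 0 < Z₁ → Z₁ ≤ Z₂ → Z₂ ≤ 1 →
        (symLatticeCount n lam a Z₂ : ℝ) ≤
          Cc * (Z₂ / Z₁) ^ n * (symLatticeCount n lam a Z₁ : ℝ) := by
  have hn1 : (1 : ℝ) ≤ n := by exact_mod_cast hn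
  refine ⟨(10 * n * (2 * n + 1) * (2 * n)) ^ (2 * n) * (10 * n * (n + 1)) ^ n, by positivity, ?_⟩
  intro lam hlam a ha Z₁ Z₂ hZ₁ hZ hZ₂
  have ha0 : ∀ j, 0 < a j := fun j ↦ one_pos.trans (ha j)
  have hZ₂0 : 0 < Z₂ := hZ₁.trans_le hZ
  have hle : Z₂ / (2 * n) ≤ Z₂ := div_le_self hZ₂0.le (by linarith)
  have h1 := symLatticeCount_le_pow_two_mul (lam := lam) hn ha0
    (show 0 < Z₂ / (2 * n) by positivity) hle
  rw [div_div_cancel₀ hZ₂0.ne'] at h1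
  have h2 : (symLatticeCount n lam a (Z₂ / (2 * n)) : ℝ) ≤
      (10 * n * (n + 1) * (Z₂ / Z₁)) ^ n * (symLatticeCount n lam a Z₁ : ℝ) := by
    rcases le_total Z₁ (Z₂ / (2 * n)) with h | h
    · refine (symLatticeCount_le_pow hn hlam ha0 hZ₁ h (by gcongr)).trans ?_
      gcongr
    · have hone : 1 ≤ 10 * n * (n + 1) * (Z₂ / Z₁) :=
        one_le_mul_of_one_le_of_one_le (by nlinarith) ((one_le_div hZ₁).2 hZ)
      calc (symLatticeCount n lam a (Z₂ / (2 * n)) : ℝ) ≤ symLatticeCount n lam a Z₁ := by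
            exact_mod_cast symLatticeCount_mono ha0 h
        _ ≤ _ := le_mul_of_one_le_left (Nat.cast_nonneg _) (one_le_pow₀ hone)
  calc (symLatticeCount n lam a Z₂ : ℝ)
      ≤ (10 * n * (2 * n + 1) * (2 * n)) ^ (2 * n) *
        ((10 * n * (n + 1) * (Z₂ / Z₁)) ^ n * (symLatticeCount n lam a Z₁ : ℝ)) := by
        refine h1.trans ?_
        gcongr
    _ = _ := by rw [mul_pow _ (Z₂ / Z₁)]; ring
end

section
/- Let p, q, s be natural numbers and let L₁,…,L_s be real linear forms in p + q variables. For reals A, B > 0 and C₁,…,C_s > 0, let M(A, B, (C_i)) := #{(𝐱,𝐲) ∈ ℤ^p × ℤ^q : |𝐱| ≤ A, |𝐲| ≤ B, and ‖L_i(𝐱,𝐲)‖ < C_i for all 1 ≤ i ≤ s}. Then for every real ξ ≥ 1: M(A, B, (C_i)_{1≤i≤s}) ≤ (2ξ)^q · M(2A, 2B/ξ, (2C_i)_{1≤i≤s}). -/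
/-!
Statement 10: for natural numbers `p, q, s`, real linear forms `L₁,…,L_s` in `p + q`
variables, with `‖t‖` the distance from `t` to the nearest integer and
`M(A, B, (C_i)) = #{(𝐱,𝐲) ∈ ℤ^p × ℤ^q : |𝐱| ≤ A, |𝐲| ≤ B, ‖L_i(𝐱,𝐲)‖ < C_i (1 ≤ i ≤ s)}`,
one has `M(A, B, (C_i)) ≤ (2ξ)^q M(2A, 2B/ξ, (2C_i))` for every real `ξ ≥ 1`.
-/

open scoped BigOperators

/-- Distance from a real number to the nearest integer, `‖t‖ = inf_{m ∈ ℤ} |t - m|`. -/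
noncomputable def distToInt (t : ℝ) : ℝ := |t - round t|

/-- The counting function `M(A, B, (C_i))` attached to the linear forms
`L_i(𝐱,𝐲) = ∑_j c_{i,j} x_j + ∑_k c'_{i,k} y_k`. -/
noncomputable def Mcount (p q s : ℕ) (c : Fin s → Fin p → ℝ) (c' : Fin s → Fin q → ℝ)
    (A B : ℝ) (Cb : Fin s → ℝ) : ℕ :=
  Set.ncard {u : (Fin p → ℤ) × (Fin q → ℤ) |
    ‖u.1‖ ≤ A ∧ ‖u.2‖ ≤ B ∧
    ∀ i, distToInt ((∑ j, c i j * (u.1 j : ℝ)) + ∑ k, c' i k * (u.2 k : ℝ)) < Cb i}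

lemma distToInt_sub_le (a b : ℝ) : distToInt (a - b) ≤ distToInt a + distToInt b := by
  unfold distToInt
  calc |a - b - round (a - b)| ≤ |a - b - ((round a - round b : ℤ) : ℝ)| := round_le _ _
    _ = |(a - round a) - (b - round b)| := by push_cast; congr 1; ring
    _ ≤ _ := abs_sub _ _

lemma finite_setOf_norm_le_and_norm_le (p q : ℕ) (A B : ℝ) :
    {u : (Fin p → ℤ) × (Fin q → ℤ) | ‖u.1‖ ≤ A ∧ ‖u.2‖ ≤ B}.Finite := by
  have h : ∀ (n : ℕ) (R : ℝ), {x : Fin n → ℤ | ‖x‖ ≤ R}.Finite := fun n R => by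
    have := (isCompact_closedBall (0 : Fin n → ℤ) R).finite_of_discrete
    simpa [Metric.closedBall, dist_zero_right] using this
  exact (h p A).prod (h q B)

lemma Mcount_set_finite (p q s : ℕ) (c : Fin s → Fin p → ℝ) (c' : Fin s → Fin q → ℝ)
    (A B : ℝ) (Cb : Fin s → ℝ) :
    {u : (Fin p → ℤ) × (Fin q → ℤ) | ‖u.1‖ ≤ A ∧ ‖u.2‖ ≤ B ∧
      ∀ i, distToInt ((∑ j, c i j * (u.1 j : ℝ)) + ∑ k, c' i k * (u.2 k : ℝ)) < Cb i}.Finite :=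
  (finite_setOf_norm_le_and_norm_le p q A B).subset fun _ hu => ⟨hu.1, hu.2.1⟩

/-- Reals in the same cell of width `w` (cells counted from `-B`) differ by at most `w`. -/
lemma abs_sub_le_of_floor_eq_s10 {B w x y : ℝ} (hw : 0 < w) (hx : -B ≤ x) (hy : -B ≤ y)
    (h : ⌊(x + B) / w⌋₊ = ⌊(y + B) / w⌋₊) : |x - y| ≤ w := by
  have hx0 : 0 ≤ (x + B) / w := div_nonneg (by linarith) hw.le
  have hy0 : 0 ≤ (y + B) / w := div_nonneg (by linarith) hw.le
  have h1 := Nat.floor_le hx0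
  have h2 := Nat.lt_floor_add_one ((x + B) / w)
  have h3 := Nat.floor_le hy0
  have h4 := Nat.lt_floor_add_one ((y + B) / w)
  rw [h] at h1 h2
  have h5 : |(x + B) / w - (y + B) / w| ≤ 1 := abs_le.2 ⟨by linarith, by linarith⟩
  rwa [← sub_div, add_sub_add_right_eq_sub, abs_div, abs_of_pos hw, div_le_one hw] at h5

theorem statement10 (p q s : ℕ) (c : Fin s → Fin p → ℝ) (c' : Fin s → Fin q → ℝ)
    (A B : ℝ) (hA : 0 < A) (hB : 0 < B) (Cb : Fin s → ℝ) (hCb : ∀ i, 0 < Cb i)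
    (ξ : ℝ) (hξ : 1 ≤ ξ) :
    (Mcount p q s c c' A B Cb : ℝ) ≤
      (2 * ξ) ^ q * (Mcount p q s c c' (2 * A) (2 * B / ξ) (fun i => 2 * Cb i) : ℝ) := by
  classical
  unfold Mcount
  have hS := Mcount_set_finite p q s c c' A B Cb
  have hT := Mcount_set_finite p q s c c' (2 * A) (2 * B / ξ) (fun i => 2 * Cb i)
  rw [Set.ncard_eq_toFinset_card _ hS, Set.ncard_eq_toFinset_card _ hT]
  have hξ0 : 0 < ξ := by linarith
  have hw : 0 < 2 * B / ξ := by positivity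
  let cell : (Fin p → ℤ) × (Fin q → ℤ) → Fin q → ℕ := fun u k =>
    ⌊((u.2 k : ℝ) + B) / (2 * B / ξ)⌋₊
  have abs_coord : ∀ u ∈ hS.toFinset, ∀ k, |(u.2 k : ℝ)| ≤ B := fun u hu k => by
    rw [Set.Finite.mem_toFinset] at hu
    have := (norm_le_pi_norm u.2 k).trans hu.2.1
    rwa [Int.norm_eq_abs] at this
  have maps : ∀ u ∈ hS.toFinset,
      cell u ∈ Fintype.piFinset fun _ : Fin q => Finset.range (⌊ξ⌋₊ + 1) := fun u hu => by
    rw [Fintype.mem_piFinset]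
    intro k
    rw [Finset.mem_range, Nat.lt_succ_iff]
    apply Nat.floor_le_floor
    rw [div_le_iff₀ hw, mul_div_cancel₀ _ hξ0.ne']
    linarith [(abs_le.1 (abs_coord u hu k)).2]
  have fiber : ∀ b ∈ Fintype.piFinset fun _ : Fin q => Finset.range (⌊ξ⌋₊ + 1),
      (hS.toFinset.filter fun u => cell u = b).card ≤ hT.toFinset.card := fun b _ => by
    rcases (hS.toFinset.filter fun u => cell u = b).eq_empty_or_nonempty with h | ⟨v, hv⟩
    · simp [h]
    refine Finset.card_le_card_of_injOn (fun u => u - v) (fun u hu => ?_)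
      (fun _ _ _ _ h => sub_left_injective h)
    obtain ⟨hvS, hvb⟩ := Finset.mem_filter.1 hv
    obtain ⟨huS, hub⟩ := Finset.mem_filter.1 (Finset.mem_coe.1 hu)
    have hv' := hS.mem_toFinset.1 hvS
    have hu' := hS.mem_toFinset.1 huS
    rw [Finset.mem_coe, Set.Finite.mem_toFinset]
    refine ⟨?_, ?_, fun i => ?_⟩
    · refine (norm_sub_le u.1 v.1).trans ?_
      linarith [hu'.1, hv'.1]
    · refine (pi_norm_le_iff_of_nonneg hw.le).2 fun k => ?_
      rw [Int.norm_eq_abs]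
      simp only [Prod.snd_sub, Pi.sub_apply, Int.cast_sub]
      exact abs_sub_le_of_floor_eq_s10 hw (abs_le.1 (abs_coord u huS k)).1
        (abs_le.1 (abs_coord v hvS k)).1 (congrFun (hub.trans hvb.symm) k)
    · have h := distToInt_sub_le ((∑ j, c i j * (u.1 j : ℝ)) + ∑ k, c' i k * (u.2 k : ℝ))
        ((∑ j, c i j * (v.1 j : ℝ)) + ∑ k, c' i k * (v.2 k : ℝ))
      rw [add_sub_add_comm, ← Finset.sum_sub_distrib, ← Finset.sum_sub_distrib] at h
      simp only [Prod.fst_sub, Prod.snd_sub, Pi.sub_apply, Int.cast_sub, mul_sub]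
      linarith [hu'.2.2 i, hv'.2.2 i]
  have key := Finset.card_le_mul_card_image_of_maps_to maps _ fiber
  rw [Fintype.card_piFinset_const, Finset.card_range, mul_comm] at key
  calc (hS.toFinset.card : ℝ) ≤ ((⌊ξ⌋₊ : ℝ) + 1) ^ q * hT.toFinset.card := by exact_mod_cast key
    _ ≤ _ := by
      gcongr
      linarith [Nat.floor_le hξ0.le]
end

section
/- For every λ ∈ ℕ, the set A₂^λ is a Zariski-open subset of ℂ^{r+1}, and moreover #{𝐱 ∈ ℤ^{r+1} : |𝐱| ≤ P₁ and 𝐱 ∉ A₂^λ} ≪ P₁^{r+1−λ} for all P₁ ≥ 1, the implied constant depending only on F and λ. -/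
open MvPolynomial MeasureTheory
open scoped BigOperators ENNReal Classical

noncomputable section

namespace PaperTM

/-- Index type for the `n + 2` variables `(x₀,…,x_r, y_{r+1},…,y_m, z_{m+1},…,z_{n+1})`. -/
abbrev Idx (n m r : ℕ) := Fin (r + 1) ⊕ (Fin (m - r) ⊕ Fin (n - m + 1))

/-- `e(t) = exp(2 π i t)`. -/
def eexp (t : ℝ) : ℂ := Complex.exp (2 * Real.pi * Complex.I * t)

variable {n m r : ℕ}

/-- Evaluation of `F` at a triple of vectors with entries in a commutative ring. -/
def evalF {R : Type} [CommRing R] (F : MvPolynomial (Idx n m r) ℤ)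
    (x : Fin (r + 1) → R) (y : Fin (m - r) → R) (z : Fin (n - m + 1) → R) : R :=
  MvPolynomial.aeval (Sum.elim x (Sum.elim y z)) F

/-- `F` is bihomogeneous of bidegree `(d₁, d₂)`:
`F(a𝐱, ab𝐲, b𝐳) = a^{d₁} b^{d₂} F(𝐱,𝐲,𝐳)` for all scalars `a, b`. -/
def Bihomogeneous (F : MvPolynomial (Idx n m r) ℤ) (d₁ d₂ : ℕ) : Prop :=
  ∀ (R : Type) [CommRing R], ∀ (a b : R) (x : Fin (r + 1) → R) (y : Fin (m - r) → R)
    (z : Fin (n - m + 1) → R),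
    evalF F (fun i => a * x i) (fun j => a * b * y j) (fun k => b * z k) =
      a ^ d₁ * b ^ d₂ * evalF F x y z

/-- The partial derivative `∂F/∂t_i`, viewed as a polynomial with complex coefficients. -/
def pderivC (F : MvPolynomial (Idx n m r) ℤ) (i : Idx n m r) :
    MvPolynomial (Idx n m r) ℂ :=
  MvPolynomial.map (Int.castRingHom ℂ) (MvPolynomial.pderiv i F)

/-- The ideal of `V₁* = {∂F/∂x_i = 0 (0 ≤ i ≤ r), ∂F/∂y_j = 0 (r+1 ≤ j ≤ m)}`. -/
def idealV1 (F : MvPolynomial (Idx n m r) ℤ) : Ideal (MvPolynomial (Idx n m r) ℂ) :=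
  Ideal.span ((Set.range fun i : Fin (r + 1) => pderivC F (Sum.inl i)) ∪
    (Set.range fun j : Fin (m - r) => pderivC F (Sum.inr (Sum.inl j))))

/-- The ideal of `V₂* = {∂F/∂y_j = 0 (r+1 ≤ j ≤ m), ∂F/∂z_k = 0 (m+1 ≤ k ≤ n+1)}`. -/
def idealV2 (F : MvPolynomial (Idx n m r) ℤ) : Ideal (MvPolynomial (Idx n m r) ℂ) :=
  Ideal.span ((Set.range fun j : Fin (m - r) => pderivC F (Sum.inr (Sum.inl j))) ∪
    (Set.range fun k : Fin (n - m + 1) => pderivC F (Sum.inr (Sum.inr k))))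

/-- The dimension of the affine variety `V₁* ⊆ ℂ^{n+2}`. -/
def dimV1 (F : MvPolynomial (Idx n m r) ℤ) : WithBot ℕ∞ :=
  ringKrullDim (MvPolynomial (Idx n m r) ℂ ⧸ idealV1 F)

/-- The dimension of the affine variety `V₂* ⊆ ℂ^{n+2}`. -/
def dimV2 (F : MvPolynomial (Idx n m r) ℤ) : WithBot ℕ∞ :=
  ringKrullDim (MvPolynomial (Idx n m r) ℂ ⧸ idealV2 F)

/-- The polynomial `F(𝐱, 𝐘, 𝐙)` with complex coefficients obtained from `F` by specializing
the variables `𝐱` to a fixed point of `ℂ^{r+1}`. -/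
def subsX (x : Fin (r + 1) → ℂ) (p : MvPolynomial (Idx n m r) ℤ) :
    MvPolynomial (Fin (m - r) ⊕ Fin (n - m + 1)) ℂ :=
  MvPolynomial.aeval (Sum.elim (fun i => MvPolynomial.C (x i))
    (Sum.elim (fun j => MvPolynomial.X (Sum.inl j)) (fun k => MvPolynomial.X (Sum.inr k)))) p

/-- Specialization of the variables `𝐳` to a fixed point of `ℂ^{n-m+1}`. -/
def subsZ (z : Fin (n - m + 1) → ℂ) (p : MvPolynomial (Idx n m r) ℤ) :
    MvPolynomial (Fin (r + 1) ⊕ Fin (m - r)) ℂ :=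
  MvPolynomial.aeval (Sum.elim (fun i => MvPolynomial.X (Sum.inl i))
    (Sum.elim (fun j => MvPolynomial.X (Sum.inr j)) (fun k => MvPolynomial.C (z k)))) p

/-- Dimension of `V₂,𝐱* = {(𝐲,𝐳) : ∂F/∂y_j(𝐱,𝐲,𝐳) = 0, ∂F/∂z_k(𝐱,𝐲,𝐳) = 0}`. -/
def dimV2x (F : MvPolynomial (Idx n m r) ℤ) (x : Fin (r + 1) → ℂ) : WithBot ℕ∞ :=
  ringKrullDim (MvPolynomial (Fin (m - r) ⊕ Fin (n - m + 1)) ℂ ⧸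
    Ideal.span
      ((Set.range fun j : Fin (m - r) => subsX x (MvPolynomial.pderiv (Sum.inr (Sum.inl j)) F)) ∪
       (Set.range fun k : Fin (n - m + 1) => subsX x (MvPolynomial.pderiv (Sum.inr (Sum.inr k)) F))))

/-- Dimension of `V₁,𝐳* = {(𝐱,𝐲) : ∂F/∂x_i(𝐱,𝐲,𝐳) = 0, ∂F/∂y_j(𝐱,𝐲,𝐳) = 0}`. -/
def dimV1z (F : MvPolynomial (Idx n m r) ℤ) (z : Fin (n - m + 1) → ℂ) : WithBot ℕ∞ :=
  ringKrullDim (MvPolynomial (Fin (r + 1) ⊕ Fin (m - r)) ℂ ⧸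
    Ideal.span
      ((Set.range fun i : Fin (r + 1) => subsZ z (MvPolynomial.pderiv (Sum.inl i) F)) ∪
       (Set.range fun j : Fin (m - r) => subsZ z (MvPolynomial.pderiv (Sum.inr (Sum.inl j)) F))))

/-- The set `A₂^λ = {𝐱 ∈ ℂ^{r+1} : dim V₂,𝐱* < dim V₂* − (r+1) + λ}`, where `D₂ = dim V₂*`;
the inequality is stated equivalently as `dim V₂,𝐱* + (r+1) < D₂ + λ`. -/
def A2set (F : MvPolynomial (Idx n m r) ℤ) (lam D₂ : ℕ) : Set (Fin (r + 1) → ℂ) :=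
  {x | dimV2x F x + (((r + 1 : ℕ) : ℕ∞) : WithBot ℕ∞) < (((D₂ + lam : ℕ) : ℕ∞) : WithBot ℕ∞)}

/-- The set `A₁^μ = {𝐳 ∈ ℂ^{n-m+1} : dim V₁,𝐳* < dim V₁* − (n−m+1) + μ}`, where `D₁ = dim V₁*`. -/
def A1set (F : MvPolynomial (Idx n m r) ℤ) (mu D₁ : ℕ) : Set (Fin (n - m + 1) → ℂ) :=
  {z | dimV1z F z + (((n - m + 1 : ℕ) : ℕ∞) : WithBot ℕ∞) < (((D₁ + mu : ℕ) : ℕ∞) : WithBot ℕ∞)}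

/-- The exponential sum `S_d(α)`. -/
def Sd (F : MvPolynomial (Idx n m r) ℤ) (d : ℕ) (P₁ P₂ α : ℝ) : ℂ :=
  ∑' q : (Fin (r + 1) → ℤ) × (Fin (m - r) → ℤ) × (Fin (n - m + 1) → ℤ),
    if ‖q.1‖ ≤ P₁ ∧ ‖q.2.1‖ ≤ d * ‖q.1‖ * P₂ ∧ ‖q.2.2‖ ≤ P₂ then
      eexp (α * (evalF F (fun i => (d : ℤ) * q.1 i) q.2.1 q.2.2 : ℤ))
    else 0

/-- The complete exponential sum `S_{a,q,d}`. -/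
def Saqd (F : MvPolynomial (Idx n m r) ℤ) (d a q : ℕ) : ℂ :=
  ∑' b : (Fin (r + 1) → ZMod q) × (Fin (m - r) → ZMod q) × (Fin (n - m + 1) → ZMod q),
    eexp ((a : ℝ) / (q : ℝ) *
      ((evalF F (fun i => (d : ZMod q) * b.1 i) b.2.1 b.2.2).val : ℝ))

/-- The term `A_d(q) = q^{-(n+2)} ∑_{0 ≤ a < q, (a,q)=1} S_{a,q,d}` of the singular series. -/
def Aq (F : MvPolynomial (Idx n m r) ℤ) (d q : ℕ) : ℂ :=
  (q : ℂ) ^ (-((n : ℤ) + 2)) *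
    ∑ a ∈ (Finset.range q).filter fun a => Nat.gcd a q = 1, Saqd F d a q

/-- The singular series `𝔖_d`. -/
def singSeries (F : MvPolynomial (Idx n m r) ℤ) (d : ℕ) : ℂ := ∑' q : ℕ, Aq F d q

/-- The partial singular series `𝔖_d(Q)`. -/
def singSeriesPartial (F : MvPolynomial (Idx n m r) ℤ) (d Q : ℕ) : ℂ :=
  ∑ q ∈ Finset.Icc 1 Q, Aq F d q

/-- The integral `I(β)` over the region `|𝐮| ≤ 1`, `|𝐯| ≤ |𝐮|`, `|𝐰| ≤ 1`. -/
def Ibeta (F : MvPolynomial (Idx n m r) ℤ) (β : ℝ) : ℂ :=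
  ∫ p : (Fin (r + 1) → ℝ) × (Fin (m - r) → ℝ) × (Fin (n - m + 1) → ℝ),
    if ‖p.1‖ ≤ 1 ∧ ‖p.2.1‖ ≤ ‖p.1‖ ∧ ‖p.2.2‖ ≤ 1 then
      eexp (β * evalF F p.1 p.2.1 p.2.2)
    else 0

/-- The truncated singular integral `J(φ) = ∫_{|β| ≤ φ} I(β) dβ`. -/
def Jphi (F : MvPolynomial (Idx n m r) ℤ) (φ : ℝ) : ℂ :=
  ∫ β in Set.Icc (-φ) φ, Ibeta F β

/-- The singular integral `J = ∫_ℝ I(β) dβ`. -/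
def Jint (F : MvPolynomial (Idx n m r) ℤ) : ℂ := ∫ β : ℝ, Ibeta F β

/-- The constant `σ_d = d^{m-r-d₁} 𝔖_d J`. -/
def sigmaD (F : MvPolynomial (Idx n m r) ℤ) (d₁ d : ℕ) : ℂ :=
  (d : ℂ) ^ ((m : ℤ) - r - d₁) * singSeries F d * Jint F

/-- `S_{a,q,d}(𝐱)`, the complete exponential sum with `𝐱` fixed. -/
def SaqdX (F : MvPolynomial (Idx n m r) ℤ) (d : ℕ) (x : Fin (r + 1) → ℤ) (a q : ℕ) : ℂ :=
  ∑' b : (Fin (m - r) → ZMod q) × (Fin (n - m + 1) → ZMod q),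
    eexp ((a : ℝ) / (q : ℝ) *
      ((evalF F (fun i => ((d * x i : ℤ) : ZMod q)) b.1 b.2).val : ℝ))

/-- The singular series `𝔖_{d,𝐱} = ∑_q q^{-(n-r+1)} ∑_{(a,q)=1} S_{a,q,d}(𝐱)`. -/
def singSeriesX (F : MvPolynomial (Idx n m r) ℤ) (d : ℕ) (x : Fin (r + 1) → ℤ) : ℂ :=
  ∑' q : ℕ, (q : ℂ) ^ (-((n : ℤ) - r + 1)) *
    ∑ a ∈ (Finset.range q).filter fun a => Nat.gcd a q = 1, SaqdX F d x a q

/-- `I_𝐱(β) = ∫_{[-1,1]^{m-r} × [-1,1]^{n-m+1}} e(β F(𝐱, k𝐯, 𝐰)) d𝐯 d𝐰` with `k = |𝐱|`. -/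
def IbetaX (F : MvPolynomial (Idx n m r) ℤ) (x : Fin (r + 1) → ℤ) (β : ℝ) : ℂ :=
  ∫ p : (Fin (m - r) → ℝ) × (Fin (n - m + 1) → ℝ),
    if ‖p.1‖ ≤ 1 ∧ ‖p.2‖ ≤ 1 then
      eexp (β * evalF F (fun i => (x i : ℝ)) (fun j => ‖x‖ * p.1 j) p.2)
    else 0

/-- `J_{d,𝐱} = ∫_ℝ I_𝐱(d^{d₁} β) dβ`. -/
def JdX (F : MvPolynomial (Idx n m r) ℤ) (d₁ d : ℕ) (x : Fin (r + 1) → ℤ) : ℂ :=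
  ∫ β : ℝ, IbetaX F x ((d : ℝ) ^ d₁ * β)

/-- `S_{a,q,d}(𝐳)`, the complete exponential sum with `𝐳` fixed. -/
def SaqdZ (F : MvPolynomial (Idx n m r) ℤ) (d : ℕ) (z : Fin (n - m + 1) → ℤ) (a q : ℕ) : ℂ :=
  ∑' b : (Fin (r + 1) → ZMod q) × (Fin (m - r) → ZMod q),
    eexp ((a : ℝ) / (q : ℝ) *
      ((evalF F (fun i => (d : ZMod q) * b.1 i) b.2 (fun k => ((z k : ℤ) : ZMod q))).val : ℝ))

/-- The singular series `𝔖_{d,𝐳} = ∑_q q^{-(m+1)} ∑_{(a,q)=1} S_{a,q,d}(𝐳)`. -/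
def singSeriesZ (F : MvPolynomial (Idx n m r) ℤ) (d : ℕ) (z : Fin (n - m + 1) → ℤ) : ℂ :=
  ∑' q : ℕ, (q : ℂ) ^ (-((m : ℤ) + 1)) *
    ∑ a ∈ (Finset.range q).filter fun a => Nat.gcd a q = 1, SaqdZ F d z a q

/-- `I_𝐳(β) = ∫_{(𝐮,𝐯) ∈ [-1,1]^{r+1} × [-1,1]^{m-r}, |𝐯| < |𝐮|} e(β F(𝐮, l𝐯, 𝐳)) d𝐮 d𝐯`
with `l = |𝐳|`. -/
def IbetaZ (F : MvPolynomial (Idx n m r) ℤ) (z : Fin (n - m + 1) → ℤ) (β : ℝ) : ℂ :=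
  ∫ p : (Fin (r + 1) → ℝ) × (Fin (m - r) → ℝ),
    if ‖p.1‖ ≤ 1 ∧ ‖p.2‖ ≤ 1 ∧ ‖p.2‖ < ‖p.1‖ then
      eexp (β * evalF F p.1 (fun j => ‖z‖ * p.2 j) (fun k => (z k : ℝ)))
    else 0

/-- `J_𝐳 = ∫_ℝ I_𝐳(β) dβ`. -/
def JZ (F : MvPolynomial (Idx n m r) ℤ) (z : Fin (n - m + 1) → ℤ) : ℂ :=
  ∫ β : ℝ, IbetaZ F z β

/-- The major arcs `𝔐^{(1)}(θ)` (with `dt = d̃ = d₁ + d₂ - 2`). -/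
def majorArc1 (d d₁ dt : ℕ) (P θ : ℝ) : Set ℝ :=
  {α | α ∈ Set.Icc (0 : ℝ) 1 ∧ ∃ q a : ℕ, 0 < q ∧ d ∣ q ∧ a < q ∧
    (q : ℝ) ≤ d * P ^ (((dt : ℝ) + 1) * θ) ∧
    |α * q - a| ≤ ((d : ℝ) ^ (d₁ - 1))⁻¹ * P ^ (-1 + ((dt : ℝ) + 1) * θ)}

/-- The major arcs `𝔐^{(2)}(θ)`. -/
def majorArc2 (d d₁ dt : ℕ) (P θ : ℝ) : Set ℝ :=
  {α | α ∈ Set.Icc (0 : ℝ) 1 ∧ ∃ q a : ℕ, 0 < q ∧ a < q ∧ Nat.gcd a q = 1 ∧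
    (q : ℝ) ≤ P ^ (((dt : ℝ) + 1) * θ) ∧
    |α * q - a| ≤ ((d : ℝ) ^ d₁)⁻¹ * P ^ (-1 + ((dt : ℝ) + 1) * θ)}

/-- The minor arcs `𝔪(θ) = [0,1) \ (𝔐^{(1)}(θ) ∪ 𝔐^{(2)}(θ))`. -/
def minorArcs (d d₁ dt : ℕ) (P θ : ℝ) : Set ℝ :=
  Set.Ico (0 : ℝ) 1 \ (majorArc1 d d₁ dt P θ ∪ majorArc2 d d₁ dt P θ)

/-! ### Krull dimension of integral extensions and transcendence degree -/

theorem zero_le_ringKrullDim_iff {R : Type*} [CommRing R] : 0 ≤ ringKrullDim R ↔ Nontrivial R := by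
  refine ⟨fun h => ?_, fun _ => ringKrullDim_nonneg_of_nontrivial⟩
  by_contra hR
  rw [not_nontrivial_iff_subsingleton] at hR
  rw [ringKrullDim_eq_bot_of_subsingleton] at h
  exact absurd h (by simp)

theorem ringKrullDim_le_of_isIntegral (R S : Type*) [CommRing R] [CommRing S] [Algebra R S]
    [Algebra.IsIntegral R S] : ringKrullDim S ≤ ringKrullDim R :=
  Order.krullDim_le_of_strictMono (PrimeSpectrum.comap (algebraMap R S))
    fun _ _ h => Ideal.IsIntegral.comap_lt_comap h

theorem ringKrullDim_le_of_isIntegral_of_injective (R S : Type*) [CommRing R] [CommRing S]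
    [Algebra R S] [Algebra.IsIntegral R S] (h : Function.Injective (algebraMap R S)) :
    ringKrullDim R ≤ ringKrullDim S := by
  refine iSup_le fun l => ?_
  obtain ⟨P, -, hP, hPl⟩ := Ideal.exists_ideal_over_prime_of_isIntegral (S := S)
    l.head.asIdeal ⊥ (by
      rw [Ideal.comap_bot_of_injective _ h]; exact bot_le)
  have : P.LiesOver l.head.asIdeal := ⟨hPl.symm⟩
  obtain ⟨L, hL, -⟩ := Ideal.exists_ltSeries_of_hasGoingUp l P
  rw [← hL]
  exact Order.LTSeries.length_le_krullDim L

theorem card_le_ringKrullDim_of_algebraicIndependent {K D ι : Type} [Field K] [CommRing D]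
    [IsDomain D] [Algebra K D] [Algebra.FiniteType K D] [Finite ι] {x : ι → D}
    (hx : AlgebraicIndependent K x) : (Nat.card ι : WithBot ℕ∞) ≤ ringKrullDim D := by
  obtain ⟨s, g, hg, hint⟩ := exists_integral_inj_algHom_of_fg K D
  have hs : (Nat.card ι) ≤ s := by
    have h1 := hx.lift_cardinalMk_le_trdeg
    let _ := g.toRingHom.toAlgebra
    have : IsScalarTower K (MvPolynomial (Fin s) K) D := IsScalarTower.of_algebraMap_eq' g.comp_algebraMap.symm
    have : Algebra.IsIntegral (MvPolynomial (Fin s) K) D := ⟨hint⟩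
    have : FaithfulSMul (MvPolynomial (Fin s) K) D := (faithfulSMul_iff_algebraMap_injective _ _).2 hg
    have h2 := trdeg_add_eq (R := K) (S := MvPolynomial (Fin s) K) (A := D)
    rw [trdeg_eq_zero (R := MvPolynomial (Fin s) K) (A := D), add_zero] at h2
    rw [← h2, MvPolynomial.trdeg_of_isDomain] at h1
    have := Fintype.ofFinite ι
    simpa using h1
  let _ := g.toRingHom.toAlgebra
  have : Algebra.IsIntegral (MvPolynomial (Fin s) K) D := ⟨hint⟩
  have := ringKrullDim_le_of_isIntegral_of_injective (MvPolynomial (Fin s) K) D hg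
  refine le_trans ?_ this
  simp
  exact_mod_cast hs

/-! ### Counting integral points on an affine variety -/

/-- The integral points of the affine variety of `J` in the box `[-B, B]^σ`. -/
def integralPoints {K σ : Type} [Field K] (J : Ideal (MvPolynomial σ K)) (B : ℕ) :
    Set (σ → ℤ) :=
  {x | (∀ i, x i ∈ Finset.Icc (-B : ℤ) B) ∧ ∀ p ∈ J, eval (fun i => (x i : K)) p = 0}

theorem finite_integralPoints {K σ : Type} [Field K] [Finite σ]
    (J : Ideal (MvPolynomial σ K)) (B : ℕ) : (integralPoints J B).Finite := by
  have := Fintype.ofFinite σ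
  refine (Fintype.piFinset fun _ : σ => Finset.Icc (-B : ℤ) B).finite_toSet.subset fun x hx => ?_
  exact Finset.mem_coe.2 (Fintype.mem_piFinset.2 hx.1)

theorem integralPoints_subset_union {K σ : Type} [Field K] {J : Ideal (MvPolynomial σ K)}
    {a b : MvPolynomial σ K} (hab : a * b ∈ J) (B : ℕ) :
    integralPoints J B ⊆
      integralPoints (J ⊔ Ideal.span {a}) B ∪ integralPoints (J ⊔ Ideal.span {b}) B := by
  intro x hx
  have key : ∀ c : MvPolynomial σ K, eval (fun i => (x i : K)) c = 0 →
      x ∈ integralPoints (J ⊔ Ideal.span {c}) B := by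
    refine fun c hc => ⟨hx.1, ?_⟩
    change J ⊔ Ideal.span {c} ≤ RingHom.ker (eval fun i => (x i : K))
    refine sup_le hx.2 ?_
    rw [Ideal.span_le, Set.singleton_subset_iff]
    exact hc
  have h := hx.2 _ hab
  rw [map_mul, mul_eq_zero] at h
  exact h.imp (key a) (key b)

/-- On a fixed fibre of the projection to a set of coordinates, away from the vanishing of a
leading coefficient, each coordinate satisfies a fixed nonzero polynomial. -/
theorem exists_card_integralPoints_le_of_isPrime {K σ : Type} [Field K] [CharZero K] [Finite σ]
    (P : Ideal (MvPolynomial σ K)) [P.IsPrime] {k : ℕ}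
    (hk : ringKrullDim (MvPolynomial σ K ⧸ P) ≤ k) :
    ∃ a ∉ P, ∃ C : ℕ, ∀ B : ℕ, 1 ≤ B →
      {x ∈ integralPoints P B | eval (fun i => (x i : K)) a ≠ 0}.ncard ≤ C * B ^ k := by
  have := Fintype.ofFinite σ
  let D := MvPolynomial σ K ⧸ P
  let π : MvPolynomial σ K →ₐ[K] D := Ideal.Quotient.mkₐ K P
  have hπ : ∀ p, π p = 0 ↔ p ∈ P := fun p => Ideal.Quotient.eq_zero_iff_mem
  let ξ : σ → D := fun j => π (X j)
  have hadj : Algebra.adjoin K (Set.range ξ) = ⊤ := by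
    have : Set.range ξ = π '' Set.range X := by rw [← Set.range_comp]; rfl
    rw [this, ← AlgHom.map_adjoin, adjoin_range_X, Algebra.map_top,
      AlgHom.range_eq_top]
    exact Ideal.Quotient.mkₐ_surjective K P
  have halg : Algebra.IsAlgebraic (Algebra.adjoin K (Set.range ξ)) D := by
    refine ⟨fun d => ?_⟩
    have hd : d ∈ Algebra.adjoin K (Set.range ξ) := hadj ▸ Algebra.mem_top
    exact isAlgebraic_algebraMap (⟨d, hd⟩ : Algebra.adjoin K (Set.range ξ))
  obtain ⟨t, ht, htb⟩ := exists_isTranscendenceBasis_subset (R := K) (Set.range ξ)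
  choose u hu using fun i : t => ht i.2
  have htfin : Finite t := (Set.finite_range ξ).subset ht
  have := Fintype.ofFinite t
  have hcard : Fintype.card t ≤ k := by
    have h := (card_le_ringKrullDim_of_algebraicIndependent htb.1).trans hk
    rw [Nat.card_eq_fintype_card] at h
    exact_mod_cast h
  have hrel : ∀ j : σ, ∃ q : Polynomial (MvPolynomial t K), q ≠ 0 ∧
      ((q.map (rename u).toRingHom).eval (X j)) ∈ P := by
    intro j
    have hnot : ¬ AlgebraicIndependent K (fun o : Option t => o.elim (ξ j) (fun i => (i : D))) := by
      rw [htb.1.option_iff_transcendental, Transcendental, not_not]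
      exact htb.isAlgebraic.isAlgebraic (ξ j)
    rw [algebraicIndependent_iff] at hnot
    push Not at hnot
    obtain ⟨g, hg, hg0⟩ := hnot
    refine ⟨optionEquivLeft K t g, by simpa using hg0, ?_⟩
    have hsub : ((optionEquivLeft K t g).map (rename u).toRingHom).eval (X j) =
        aeval (fun o : Option t => o.elim (X j) fun i => X (u i)) g := by
      clear hg hg0
      induction g using MvPolynomial.induction_on with
      | C a => simp [optionEquivLeft_C]
      | add p q hp hq => simp only [map_add, Polynomial.map_add, Polynomial.eval_add, hp, hq]
      | mul_X p i hp =>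
        rw [map_mul, Polynomial.map_mul, Polynomial.eval_mul, hp, map_mul]
        cases i <;> simp [optionEquivLeft_X_none, optionEquivLeft_X_some]
    rw [← hπ, ← hg, hsub, ← AlgHom.comp_apply, comp_aeval]
    congr 2
    ext o
    cases o <;> simp [ξ, ← hu]
  choose q hq hqP using hrel
  have hlead : ∀ j, rename u (q j).leadingCoeff ∉ P := by
    intro j hj
    rw [← hπ] at hj
    have h1 : aeval ((↑) : t → D) (q j).leadingCoeff = 0 := by
      rw [← hj, ← AlgHom.comp_apply]
      congr 1
      ext i
      simp [← hu i, ξ]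
    exact hq j (Polynomial.leadingCoeff_eq_zero.1 (algebraicIndependent_iff.1 htb.1 _ h1))
  refine ⟨∏ j, rename u (q j).leadingCoeff, ?_, (∏ j, (q j).natDegree) * 3 ^ k, ?_⟩
  · rw [Ideal.IsPrime.prod_mem_iff]
    push Not
    exact fun j _ => hlead j
  intro B hB
  have hfin : {x ∈ integralPoints P B | eval (fun i => (x i : K))
      (∏ j, rename u (q j).leadingCoeff) ≠ 0}.Finite :=
    (finite_integralPoints P B).subset (Set.sep_subset _ _)
  rw [Set.ncard_eq_toFinset_card _ hfin]
  set s := hfin.toFinset with hs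
  let f : (σ → ℤ) → (t → ℤ) := fun x i => x (u i)
  refine (Finset.card_le_mul_card_image (f := f) s (∏ j, (q j).natDegree) ?_).trans ?_
  · intro w hw
    let e : MvPolynomial t K →+* K := eval fun i => (w i : K)
    have hroot : ∀ x ∈ s, f x = w → ∀ j, (x j : K) ∈ ((q j).map e).roots.toFinset := by
      intro x hx hxw j
      rw [hs, Set.Finite.mem_toFinset] at hx
      have hren : ∀ p : MvPolynomial t K, eval (fun i => (x i : K)) (rename u p) = e p := by
        intro p
        rw [eval_rename]
        congr 2
        ext i
        simp [← hxw, f]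
      have hne : e (q j).leadingCoeff ≠ 0 := by
        have := hx.2
        rw [map_prod, Finset.prod_ne_zero_iff] at this
        rw [← hren]
        exact this j (Finset.mem_univ j)
      have hne' : (q j).map e ≠ 0 := by
        intro h0
        have := congrArg (fun p => p.coeff (q j).natDegree) h0
        simp only [Polynomial.coeff_map, Polynomial.coeff_zero] at this
        exact hne this
      rw [Multiset.mem_toFinset, Polynomial.mem_roots hne', Polynomial.IsRoot]
      have h0 := hx.1.2 _ (hqP j)
      rw [Polynomial.eval_map, Polynomial.hom_eval₂, eval_X] at h0
      rw [Polynomial.eval_map, ← h0]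
      congr 1
      exact RingHom.ext fun p => (hren p).symm
    calc (s.filter fun x => f x = w).card
        ≤ (Fintype.piFinset fun j => ((q j).map e).roots.toFinset).card := by
          refine Finset.card_le_card_of_injOn (fun x j => (x j : K)) ?_ ?_
          · intro x hx
            rw [Finset.mem_coe, Finset.mem_filter] at hx
            exact Finset.mem_coe.2 (Fintype.mem_piFinset.2 (hroot x hx.1 hx.2))
          · intro x _ y _ hxy
            ext j
            exact Int.cast_injective (α := K) (congrFun hxy j)
      _ ≤ ∏ j, (q j).natDegree := by
          rw [Fintype.card_piFinset]
          refine Finset.prod_le_prod' fun j _ => ?_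
          exact (Multiset.toFinset_card_le _).trans
            ((Polynomial.card_roots' _).trans Polynomial.natDegree_map_le)
  · rw [mul_assoc]
    refine Nat.mul_le_mul_left _ ?_
    calc (s.image f).card
        ≤ (Fintype.piFinset fun _ : t => Finset.Icc (-B : ℤ) B).card := by
          refine Finset.card_le_card fun w hw => ?_
          obtain ⟨x, hx, rfl⟩ := Finset.mem_image.1 hw
          rw [hs, Set.Finite.mem_toFinset] at hx
          exact Fintype.mem_piFinset.2 fun i => hx.1.1 (u i)
      _ = (2 * B + 1) ^ Fintype.card t := by
          rw [Fintype.card_piFinset, Finset.prod_const, Finset.card_univ, Int.card_Icc]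
          congr 1
          omega
      _ ≤ (3 * B) ^ k :=
          (Nat.pow_le_pow_left (by omega) _).trans (Nat.pow_le_pow_right (by omega) hcard)
      _ = 3 ^ k * B ^ k := mul_pow _ _ _

theorem exists_card_integralPoints_le {K σ : Type} [Field K] [CharZero K] [Finite σ] {k : ℕ}
    (J : Ideal (MvPolynomial σ K)) (hk : ringKrullDim (MvPolynomial σ K ⧸ J) ≤ k) :
    ∃ C : ℕ, ∀ B : ℕ, 1 ≤ B → (integralPoints J B).ncard ≤ C * B ^ k := by
  refine IsNoetherian.induction (P := fun J : Ideal (MvPolynomial σ K) =>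
    ringKrullDim (MvPolynomial σ K ⧸ J) ≤ k → ∃ C : ℕ, ∀ B : ℕ, 1 ≤ B →
      (integralPoints J B).ncard ≤ C * B ^ k) (fun (J : Ideal (MvPolynomial σ K)) ih hk => ?_) J hk
  have hext : ∀ a ∉ J, ∃ C : ℕ, ∀ B : ℕ, 1 ≤ B →
      (integralPoints (J ⊔ Ideal.span {a}) B).ncard ≤ C * B ^ k := by
    intro a ha
    refine ih _ ?_ ?_
    · refine lt_of_le_of_ne le_sup_left fun h => ha ?_
      rw [h]
      exact Ideal.mem_sup_right (Ideal.mem_span_singleton_self a)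
    · exact (ringKrullDim_le_of_surjective (Ideal.Quotient.factor le_sup_left)
        (Ideal.Quotient.factor_surjective _)).trans hk
  by_cases hJ : J.IsPrime
  · obtain ⟨a, ha, C, hC⟩ := exists_card_integralPoints_le_of_isPrime J hk
    obtain ⟨C', hC'⟩ := hext a ha
    refine ⟨C + C', fun B hB => ?_⟩
    rw [add_mul]
    refine le_trans ?_ (add_le_add (hC B hB) (hC' B hB))
    refine (Set.ncard_le_ncard ?_ (((finite_integralPoints J B).subset
      (Set.sep_subset _ _)).union (finite_integralPoints _ B))).trans (Set.ncard_union_le _ _)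
    intro x hx
    by_cases h : eval (fun i => (x i : K)) a = 0
    · right
      refine ⟨hx.1, ?_⟩
      change J ⊔ Ideal.span {a} ≤ RingHom.ker (eval fun i => (x i : K))
      refine sup_le hx.2 ?_
      rw [Ideal.span_le, Set.singleton_subset_iff]
      exact h
    · exact Or.inl ⟨hx, h⟩
  · rcases Ideal.not_isPrime_iff.1 hJ with rfl | ⟨a, ha, b, hb, hab⟩
    · refine ⟨0, fun B _ => ?_⟩
      have : integralPoints (⊤ : Ideal (MvPolynomial σ K)) B = ∅ := by
        ext x
        simp only [Set.mem_empty_iff_false, iff_false]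
        intro hx
        simpa using hx.2 1 trivial
      simp [this]
    · obtain ⟨C, hC⟩ := hext a ha
      obtain ⟨C', hC'⟩ := hext b hb
      refine ⟨C + C', fun B hB => ?_⟩
      rw [add_mul]
      refine le_trans ?_ (add_le_add (hC B hB) (hC' B hB))
      exact (Set.ncard_le_ncard (integralPoints_subset_union hab B)
        ((finite_integralPoints _ B).union (finite_integralPoints _ B))).trans
        (Set.ncard_union_le _ _)

/-! ### Homogeneous ideals in families -/

attribute [local instance] MvPolynomial.gradedAlgebra

theorem isHomogeneous_map {τ R S : Type*} [CommRing R] [CommRing S]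
    {I : Ideal (MvPolynomial τ R)} (hI : I.IsHomogeneous (homogeneousSubmodule τ R))
    (φ : R →+* S) :
    (I.map (map φ)).IsHomogeneous (homogeneousSubmodule τ S) := by
  obtain ⟨s, rfl⟩ := (Ideal.IsHomogeneous.iff_exists _ _).1 hI
  rw [Ideal.map_span]
  refine Ideal.homogeneous_span _ _ ?_
  rintro _ ⟨_, ⟨⟨f, d, hf⟩, -, rfl⟩, rfl⟩
  exact ⟨d, (mem_homogeneousSubmodule d _).2 (((mem_homogeneousSubmodule d _).1 hf).map φ)⟩

/-- The main theorem of elimination theory, in the form that the vanishing locus of a family of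
homogeneous ideals being empty is an open condition. -/
theorem exists_ne_zero_forall_pow_idealOfVars_le {τ A K : Type*} [Finite τ] [CommRing A] [Field K]
    {I : Ideal (MvPolynomial τ A)} (hI : I.IsHomogeneous (homogeneousSubmodule τ A))
    {φ : A →+* K} (hφ : Function.Surjective φ) {e : ℕ}
    (h : idealOfVars τ K ^ e ≤ I.map (map φ)) :
    ∃ a : A, φ a ≠ 0 ∧ ∀ ψ : A →+* K, ψ a ≠ 0 → idealOfVars τ K ^ e ≤ I.map (map ψ) := by
  obtain ⟨a, ha, haI⟩ := Submodule.exists_sub_one_mem_and_smul_le_of_fg_of_le_sup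
    (I := RingHom.ker φ) (N := I.restrictScalars A) (homogeneousSubmodule_fg τ A e) le_rfl (by
      intro p hp
      rw [mem_homogeneousSubmodule] at hp
      have hp' : map φ p ∈ I.map (map φ) := by
        refine h ((mem_pow_idealOfVars_iff _ _).2 fun x hx => ?_)
        exact (((hp.map φ).degree_eq_sum_deg_support hx).trans (Finsupp.degree_apply x).symm).le
      obtain ⟨g, hg, hgp⟩ := (Ideal.mem_map_iff_of_surjective _ (map_surjective φ hφ)).1 hp'
      have hge := homogeneousComponent_mem_of_mem hI hg e
      have hq : (p - homogeneousComponent e g).IsHomogeneous e :=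
        hp.sub (homogeneousComponent_isHomogeneous e g)
      rw [← add_sub_cancel (homogeneousComponent e g) p]
      refine add_mem (Submodule.mem_sup_left hge) (Submodule.mem_sup_right ?_)
      rw [(p - homogeneousComponent e g).as_sum]
      refine Submodule.sum_mem _ fun x hx => ?_
      rw [← mul_one (coeff x _), ← smul_eq_mul, ← smul_monomial]
      refine Submodule.smul_mem_smul ?_ ((mem_homogeneousSubmodule _ _).2
        (isHomogeneous_monomial _ ?_))
      · have hx0 : x.degree = e := by
          by_contra hne
          exact mem_support_iff.1 hx (hq.coeff_eq_zero hne)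
        rw [RingHom.mem_ker, coeff_sub, coeff_homogeneousComponent, if_pos hx0, map_sub,
          ← coeff_map, ← coeff_map, hgp, sub_self]
      · by_contra hne
        exact mem_support_iff.1 hx (hq.coeff_eq_zero hne))
  refine ⟨a, ?_, fun ψ hψ => ?_⟩
  · intro h0
    rw [RingHom.mem_ker, map_sub, h0, map_one] at ha
    simp at ha
  rw [pow_idealOfVars_eq_span, Ideal.span_le]
  rintro _ ⟨μ, hμ, rfl⟩
  have hm : a • monomial μ (1 : A) ∈ I :=
    haI (Submodule.smul_mem_pointwise_smul _ a _
      ((mem_homogeneousSubmodule _ _).2 (isHomogeneous_monomial _ hμ)))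
  have := Ideal.mem_map_of_mem (map ψ) hm
  rw [smul_monomial, map_monomial] at this
  have h2 := Ideal.mul_mem_left _ (C (ψ a)⁻¹) this
  rw [C_mul_monomial] at h2
  simpa [hψ] using h2

/-! ### Cutting by general linear combinations -/

theorem ringKrullDim_succ_le_of_isPrime_of_lt {R : Type*} [CommRing R] {P Q : Ideal R} [P.IsPrime]
    (h : P < Q) : ringKrullDim (R ⧸ Q) + 1 ≤ ringKrullDim (R ⧸ P) := by
  obtain ⟨a, haQ, haP⟩ := SetLike.exists_of_lt h
  refine ringKrullDim_succ_le_of_surjective (Ideal.Quotient.factor h.le)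
    (Ideal.Quotient.factor_surjective h.le) (r := Ideal.Quotient.mk P a) ?_ ?_
  · exact mem_nonZeroDivisors_of_ne_zero fun h0 => haP (Ideal.Quotient.eq_zero_iff_mem.1 h0)
  · rw [Ideal.Quotient.factor_mk]
    exact Ideal.Quotient.eq_zero_iff_mem.2 haQ

theorem lt_natCast_of_add_one_le {a b : WithBot ℕ∞} {d : ℕ} (hab : a + 1 ≤ b)
    (hb : b < ((d + 1 : ℕ) : WithBot ℕ∞)) : a < d := by
  have h := hab.trans_lt hb
  push_cast at h
  exact lt_of_add_lt_add_right h

/-- Away from the locus `y = 0`, the vanishing locus of `J` has dimension less than `d`. -/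
def DimOffLT {R τ : Type*} [CommRing R] (J : Ideal R) (y : τ → R) (d : ℕ) : Prop :=
  ∀ Q : Ideal R, Q.IsPrime → J ≤ Q → (∃ i, y i ∉ Q) → ringKrullDim (R ⧸ Q) < d

theorem DimOffLT.exists_sup_span_linearCombination {K R τ : Type*} [Field K] [Infinite K]
    [CommRing R] [IsNoetherianRing R] [Algebra K R] [Fintype τ] {J : Ideal R} {y : τ → R} {d : ℕ}
    (h : DimOffLT J y (d + 1)) :
    ∃ c : τ → K, DimOffLT (J ⊔ Ideal.span {Fintype.linearCombination K y c}) y d := by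
  let V : Ideal R → Subspace K (τ → K) := fun P =>
    (P.restrictScalars K).comap (Fintype.linearCombination K y)
  have hfin : {P ∈ J.minimalPrimes | ∃ i, y i ∉ P}.Finite :=
    (Ideal.finite_minimalPrimes_of_isNoetherianRing R J).subset (Set.sep_subset _ _)
  have htop : ⊤ ∉ hfin.toFinset.image V := by
    intro ht
    obtain ⟨P, hP, hPV⟩ := Finset.mem_image.1 ht
    obtain ⟨i, hi⟩ := (hfin.mem_toFinset.1 hP).2
    have : Pi.single i 1 ∈ V P := hPV ▸ Submodule.mem_top
    rw [Submodule.mem_comap, Fintype.linearCombination_apply_single, one_smul] at this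
    exact hi this
  obtain ⟨c, hc⟩ := (Set.ne_univ_iff_exists_notMem _).1
    (Subspace.biUnion_ne_univ_of_top_notMem htop)
  refine ⟨c, fun Q hQ hJQ hy => ?_⟩
  obtain ⟨P, hP, hPQ⟩ := Ideal.exists_minimalPrimes_le (le_sup_left.trans hJQ)
  have := hP.1.1
  have hyP : ∃ i, y i ∉ P := hy.imp fun i hi hiP => hi (hPQ hiP)
  have hcP : Fintype.linearCombination K y c ∉ P := fun hcP =>
    hc (Set.mem_biUnion (Finset.mem_coe.2 (Finset.mem_image_of_mem V
      (hfin.mem_toFinset.2 ⟨hP, hyP⟩))) hcP)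
  have hlt : P < Q := lt_of_le_of_ne hPQ fun hPQ' =>
    hcP (hPQ' ▸ hJQ (Ideal.mem_sup_right (Ideal.mem_span_singleton_self _)))
  exact lt_natCast_of_add_one_le (ringKrullDim_succ_le_of_isPrime_of_lt hlt)
    (h P this hP.1.2 hyP)

theorem DimOffLT.exists_sup_span_image_linearCombination (K : Type*) {R τ : Type*} [Field K]
    [Infinite K] [CommRing R] [IsNoetherianRing R] [Algebra K R] [Fintype τ] {J : Ideal R}
    {y : τ → R} {d : ℕ} (s : ℕ) (h : DimOffLT J y (d + s)) :
    ∃ L : Finset (τ → K), L.card ≤ s ∧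
      DimOffLT (J ⊔ Ideal.span (Fintype.linearCombination K y '' L)) y d := by
  induction s generalizing J with
  | zero => exact ⟨∅, le_rfl, by simpa using h⟩
  | succ s ih =>
    obtain ⟨c, hc⟩ := h.exists_sup_span_linearCombination (K := K)
    obtain ⟨L, hL, hJ⟩ := ih hc
    refine ⟨insert c L, (Finset.card_insert_le _ _).trans (by omega), ?_⟩
    rwa [Finset.coe_insert, Set.image_insert_eq, Ideal.span_insert, ← sup_assoc]

/-! ### Dimension of cones and linear sections -/

theorem homogeneousComponent_mul_of_isHomogeneous_one {τ R : Type*} [CommRing R]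
    {l : MvPolynomial τ R} (hl : l.IsHomogeneous 1) (p : MvPolynomial τ R) :
    homogeneousComponent 0 (p * l) = 0 ∧
      ∀ d, homogeneousComponent (d + 1) (p * l) = homogeneousComponent d p * l := by
  have key : ∀ d i, homogeneousComponent d (homogeneousComponent i p * l) =
      if i + 1 = d then homogeneousComponent i p * l else 0 := fun d i =>
    homogeneousComponent_of_mem ((mem_homogeneousSubmodule _ _).2
      ((homogeneousComponent_isHomogeneous i p).mul hl))|>.trans (by simp only [eq_comm])
  have hsum : p * l = ∑ i ∈ Finset.range (p.totalDegree + 1), homogeneousComponent i p * l := by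
    rw [← Finset.sum_mul, sum_homogeneousComponent]
  constructor
  · rw [hsum, map_sum]
    refine Finset.sum_eq_zero fun i _ => ?_
    rw [key, if_neg (Nat.succ_ne_zero i)]
  · intro d
    rw [hsum, map_sum]
    simp only [key, Nat.add_right_cancel_iff]
    rw [Finset.sum_ite_eq' (Finset.range (p.totalDegree + 1)) d]
    split_ifs with hd
    · rfl
    · rw [homogeneousComponent_eq_zero _ _ (by rw [Finset.mem_range] at hd; omega), zero_mul]

theorem isHomogeneous_linearCombination_X {K A τ : Type*} [Fintype τ] [Field K] [CommRing A]
    [Algebra K A] (c : τ → K) :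
    (Fintype.linearCombination K (X : τ → MvPolynomial τ A) c).IsHomogeneous 1 := by
  rw [Fintype.linearCombination_apply]
  refine IsHomogeneous.sum _ _ _ fun i _ => ?_
  rw [algebra_compatible_smul A, smul_eq_C_mul]
  exact (isHomogeneous_X A i).C_mul _

theorem ringKrullDim_le_card_of_pow_idealOfVars_le {K τ : Type*} [Fintype τ] [Field K]
    {J : Ideal (MvPolynomial τ K)} (hJ : J.IsHomogeneous (homogeneousSubmodule τ K))
    {L : Finset (τ → K)} {e : ℕ}
    (h : idealOfVars τ K ^ e ≤ J ⊔ Ideal.span (Fintype.linearCombination K X '' L)) :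
    ringKrullDim (MvPolynomial τ K ⧸ J) ≤ L.card := by
  let S := MvPolynomial L K
  let ℓ : L → MvPolynomial τ K := fun c => Fintype.linearCombination K X c
  have hℓ : Fintype.linearCombination K X '' (L : Set (τ → K)) = Set.range ℓ :=
    Set.image_eq_range _ _
  rw [hℓ] at h
  let _ : Algebra S (MvPolynomial τ K) := (aeval ℓ : S →ₐ[K] MvPolynomial τ K).toRingHom.toAlgebra
  have hsmul : ∀ (s : S) (p : MvPolynomial τ K), s • p = aeval ℓ s * p := fun _ _ => rfl
  let M : Set (MvPolynomial τ K) := (fun μ => monomial μ (1 : K)) '' {μ | μ.degree < e}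
  have hM : M.Finite := (Finsupp.finite_of_degree_lt e).image _
  let N : Submodule S (MvPolynomial τ K) := Submodule.span S M ⊔ J.restrictScalars S
  have hJN : ∀ p ∈ J, p ∈ N := fun p hp => Submodule.mem_sup_right hp
  have hCN : ∀ (a : K), ∀ p ∈ N, C a * p ∈ N := by
    intro a p hp
    have := N.smul_mem (C a) hp
    rwa [hsmul, aeval_C] at this
  have hlN : ∀ (c : L), ∀ p ∈ N, p * ℓ c ∈ N := by
    intro c p hp
    have := N.smul_mem (X c) hp
    rwa [hsmul, aeval_X, mul_comm] at this
  have hℓ1 : ∀ c, (ℓ c).IsHomogeneous 1 := fun c => isHomogeneous_linearCombination_X (c : τ → K)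
  have hdeg : ∀ d, ∀ p : MvPolynomial τ K, p.IsHomogeneous d → ∀ x ∈ p.support, x.degree = d := by
    intro d p hp x hx
    by_contra hne
    exact mem_support_iff.1 hx (hp.coeff_eq_zero hne)
  have hlow : ∀ d < e, ∀ p : MvPolynomial τ K, p.IsHomogeneous d → p ∈ N := by
    intro d hd p hp
    rw [p.as_sum]
    refine Submodule.sum_mem _ fun x hx => ?_
    rw [← mul_one (coeff x p), ← C_mul_monomial]
    refine hCN _ _ (Submodule.mem_sup_left (Submodule.subset_span ⟨x, ?_, rfl⟩))
    exact (hdeg d p hp x hx).trans_lt hd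
  have hhigh : ∀ d ≥ e, ∀ p : MvPolynomial τ K, p.IsHomogeneous d →
      ∃ j ∈ J, ∃ f : L → MvPolynomial τ K, j + ∑ c, f c * ℓ c = p := by
    intro d hd p hp
    have hpe : p ∈ idealOfVars τ K ^ e :=
      (mem_pow_idealOfVars_iff _ _).2 fun x hx => hd.trans (hdeg d p hp x hx).ge
    obtain ⟨j, hj, q, hq, rfl⟩ := Submodule.mem_sup.1 (h hpe)
    obtain ⟨f, rfl⟩ := Ideal.mem_span_range_iff_exists_fun.1 hq
    exact ⟨j, hj, f, rfl⟩
  have hhom : ∀ d : ℕ, ∀ p : MvPolynomial τ K, p.IsHomogeneous d → p ∈ N := by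
    intro d
    induction d with
    | zero =>
      intro p hp
      rcases lt_or_ge 0 e with he | he
      · exact hlow 0 he p hp
      · obtain ⟨j, hj, f, rfl⟩ := hhigh 0 he p hp
        rw [← homogeneousComponent_eq_self hp, map_add, map_sum]
        refine add_mem (hJN _ (homogeneousComponent_mem_of_mem hJ hj 0))
          (Submodule.sum_mem _ fun c _ => ?_)
        rw [(homogeneousComponent_mul_of_isHomogeneous_one (hℓ1 c) _).1]
        exact zero_mem _
    | succ d ih =>
      intro p hp
      rcases lt_or_ge (d + 1) e with he | he
      · exact hlow (d + 1) he p hp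
      · obtain ⟨j, hj, f, rfl⟩ := hhigh (d + 1) he p hp
        rw [← homogeneousComponent_eq_self hp, map_add, map_sum]
        refine add_mem (hJN _ (homogeneousComponent_mem_of_mem hJ hj _))
          (Submodule.sum_mem _ fun c _ => ?_)
        rw [(homogeneousComponent_mul_of_isHomogeneous_one (hℓ1 c) _).2]
        exact hlN c _ (ih _ (homogeneousComponent_isHomogeneous d _))
  have htop : N = ⊤ := by
    refine Submodule.eq_top_iff'.2 fun p => ?_
    rw [← sum_homogeneousComponent p]
    exact Submodule.sum_mem _ fun i _ => hhom i _ (homogeneousComponent_isHomogeneous i p)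
  have : Module.Finite S (MvPolynomial τ K ⧸ J) := by
    refine ⟨?_⟩
    have hfg := (Submodule.fg_span (R := S) hM).map (Ideal.Quotient.mkₐ S J).toLinearMap
    rwa [show Submodule.map (Ideal.Quotient.mkₐ S J).toLinearMap (Submodule.span S M) = ⊤ from ?_]
      at hfg
    refine Submodule.eq_top_iff'.2 fun x => ?_
    obtain ⟨p, rfl⟩ := Ideal.Quotient.mk_surjective x
    have hp : p ∈ N := htop ▸ Submodule.mem_top
    obtain ⟨a, ha, b, hb, rfl⟩ := Submodule.mem_sup.1 hp
    refine ⟨a, ha, ?_⟩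
    exact (Ideal.Quotient.eq.2 (by simpa using hb))
  have hdim := ringKrullDim_le_of_isIntegral S (MvPolynomial τ K ⧸ J)
  simpa [S] using hdim

theorem isHomogeneous_of_mem_minimalPrimes {τ A : Type*} [CommRing A]
    {I : Ideal (MvPolynomial τ A)} (hI : I.IsHomogeneous (homogeneousSubmodule τ A))
    {Q : Ideal (MvPolynomial τ A)} (hQ : Q ∈ I.minimalPrimes) :
    Q.IsHomogeneous (homogeneousSubmodule τ A) := by
  have hprime := Ideal.IsPrime.homogeneousCore (𝒜 := homogeneousSubmodule τ A) hQ.1.1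
  have hle := Ideal.toIdeal_homogeneousCore_le (homogeneousSubmodule τ A) Q
  have hI' : I ≤ (Q.homogeneousCore (homogeneousSubmodule τ A)).toIdeal :=
    hI.toIdeal_homogeneousCore_eq_self ▸ Ideal.homogeneousCore_mono _ hQ.1.2
  rw [← le_antisymm hle (hQ.2 ⟨hprime, hI'⟩ hle)]
  exact (Q.homogeneousCore _).isHomogeneous

theorem C_coeff_zero_mem_of_isHomogeneous {τ A : Type*} [CommRing A]
    {Q : Ideal (MvPolynomial τ A)} (hQ : Q.IsHomogeneous (homogeneousSubmodule τ A))
    {f : MvPolynomial τ A} (hf : f ∈ Q) : C (coeff 0 f) ∈ Q :=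
  homogeneousComponent_zero f ▸ homogeneousComponent_mem_of_mem hQ hf 0

theorem isHomogeneous_sup_span_linearCombination {K A τ : Type*} [Fintype τ] [Field K] [CommRing A]
    [Algebra K A] {I : Ideal (MvPolynomial τ A)}
    (hI : I.IsHomogeneous (homogeneousSubmodule τ A)) (L : Set (τ → K)) :
    (I ⊔ Ideal.span (Fintype.linearCombination K X '' L)).IsHomogeneous
      (homogeneousSubmodule τ A) := by
  refine hI.sup (Ideal.homogeneous_span _ _ ?_)
  rintro _ ⟨c, -, rfl⟩
  exact ⟨1, (mem_homogeneousSubmodule _ _).2 (isHomogeneous_linearCombination_X c)⟩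

theorem map_sup_span_linearCombination {K A τ : Type*} [Fintype τ] [Field K] [CommRing A]
    [Algebra K A] (I : Ideal (MvPolynomial τ A)) (L : Set (τ → K)) (φ : A →ₐ[K] K) :
    (I ⊔ Ideal.span (Fintype.linearCombination K X '' L)).map (map (φ : A →+* K)) =
      I.map (map (φ : A →+* K)) ⊔ Ideal.span (Fintype.linearCombination K X '' L) := by
  rw [Ideal.map_sup, Ideal.map_span, ← Set.image_comp]
  congr 3
  ext1 c
  simp only [Function.comp_apply, Fintype.linearCombination_apply, map_sum]
  refine Finset.sum_congr rfl fun i _ => ?_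
  rw [algebra_compatible_smul A, smul_eq_C_mul, map_mul, map_C, map_X, smul_eq_C_mul]
  congr 2
  exact φ.commutes (c i)

theorem exists_pow_idealOfVars_le_of_ringKrullDim_lt {K τ : Type*} [Fintype τ] [Field K]
    [Infinite K] {J : Ideal (MvPolynomial τ K)}
    (hJ : J.IsHomogeneous (homogeneousSubmodule τ K)) {s : ℕ}
    (h : ringKrullDim (MvPolynomial τ K ⧸ J) < ((s + 1 : ℕ) : WithBot ℕ∞)) :
    ∃ L : Finset (τ → K), L.card ≤ s ∧ ∃ e : ℕ,
      idealOfVars τ K ^ e ≤ J ⊔ Ideal.span (Fintype.linearCombination K X '' L) := by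
  have hoff : DimOffLT J (X : τ → MvPolynomial τ K) (1 + s) := by
    intro Q _ hJQ _
    rw [add_comm 1 s]
    exact (ringKrullDim_le_of_surjective _ (Ideal.Quotient.factor_surjective hJQ)).trans_lt h
  obtain ⟨L, hL, hoff'⟩ := hoff.exists_sup_span_image_linearCombination K
  refine ⟨L, hL, Ideal.exists_pow_le_of_le_radical_of_fg ?_ (idealOfVars_fg τ K)⟩
  rw [← Ideal.sInf_minimalPrimes]
  refine le_sInf fun Q hQ => ?_
  have := hQ.1.1
  rw [idealOfVars, Ideal.span_le]
  rintro _ ⟨i, rfl⟩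
  by_contra hi
  have hQm : Q ≤ idealOfVars τ K := by
    intro f hf
    rw [← pow_one (idealOfVars τ K), mem_pow_idealOfVars_iff']
    intro x hx
    have hx0 : x = 0 := (Finsupp.degree_eq_zero_iff x).1 (Nat.lt_one_iff.1 hx)
    subst hx0
    by_contra h0
    refine this.ne_top (Ideal.eq_top_of_isUnit_mem Q (C_coeff_zero_mem_of_isHomogeneous
      (isHomogeneous_of_mem_minimalPrimes
        (isHomogeneous_sup_span_linearCombination hJ _) hQ) hf) ?_)
    exact (isUnit_iff_ne_zero.2 h0).map C
  have hlt : Q < idealOfVars τ K :=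
    lt_of_le_of_ne hQm fun h => hi (h ▸ Ideal.subset_span ⟨i, rfl⟩)
  have hne : Nontrivial (MvPolynomial τ K ⧸ idealOfVars τ K) := by
    rw [Ideal.Quotient.nontrivial_iff, Ne, Ideal.eq_top_iff_one, ← C_1,
      ← pow_one (idealOfVars τ K), C_mem_pow_idealOfVars_iff]
    simp
  have hneg := lt_natCast_of_add_one_le (ringKrullDim_succ_le_of_isPrime_of_lt hlt)
    (d := 0) (by simpa using hoff' Q this hQ.1.2 ⟨i, hi⟩)
  exact absurd ringKrullDim_nonneg_of_nontrivial (not_le.2 (by simpa using hneg))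

/-- Upper semicontinuity of the dimension of the fibres of a family of cones. -/
theorem exists_ne_zero_forall_ringKrullDim_lt {K A τ : Type*} [Fintype τ] [Field K] [Infinite K]
    [CommRing A] [Algebra K A] {I : Ideal (MvPolynomial τ A)}
    (hI : I.IsHomogeneous (homogeneousSubmodule τ A)) {φ₀ : A →ₐ[K] K} {s : ℕ}
    (h : ringKrullDim (MvPolynomial τ K ⧸ I.map (map (φ₀ : A →+* K))) < s) :
    ∃ a : A, φ₀ a ≠ 0 ∧ ∀ φ : A →ₐ[K] K, φ a ≠ 0 →
      ringKrullDim (MvPolynomial τ K ⧸ I.map (map (φ : A →+* K))) < s := by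
  have hsurj : Function.Surjective (φ₀ : A →+* K) := fun c => ⟨algebraMap K A c, φ₀.commutes c⟩
  cases s with
  | zero =>
    have key : ∀ J : Ideal (MvPolynomial τ K), ringKrullDim (MvPolynomial τ K ⧸ J) < (0 : ℕ) ↔
        idealOfVars τ K ^ 0 ≤ J := by
      intro J
      rw [pow_zero, Ideal.one_eq_top, top_le_iff, ← Ideal.Quotient.subsingleton_iff,
        ← not_iff_not, not_subsingleton_iff_nontrivial, not_lt, Nat.cast_zero,
        zero_le_ringKrullDim_iff]
    obtain ⟨a, ha, hφ⟩ := exists_ne_zero_forall_pow_idealOfVars_le hI hsurj ((key _).1 h)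
    exact ⟨a, ha, fun φ hφa => (key _).2 (hφ φ hφa)⟩
  | succ s =>
    obtain ⟨L, hL, e, he⟩ := exists_pow_idealOfVars_le_of_ringKrullDim_lt (isHomogeneous_map hI _) h
    rw [← map_sup_span_linearCombination] at he
    obtain ⟨a, ha, hφ⟩ := exists_ne_zero_forall_pow_idealOfVars_le
      (isHomogeneous_sup_span_linearCombination hI _) hsurj he
    refine ⟨a, ha, fun φ hφa => ?_⟩
    have := hφ φ hφa
    rw [map_sup_span_linearCombination] at this
    refine (ringKrullDim_le_card_of_pow_idealOfVars_le (isHomogeneous_map hI _) this).trans_lt ?_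
    exact_mod_cast Nat.lt_succ_of_le hL

theorem exists_surjective_quotient_comap_C {τ A : Type*} [CommRing A]
    {Q : Ideal (MvPolynomial τ A)} (hQ : Q.IsHomogeneous (homogeneousSubmodule τ A)) :
    ∃ f : MvPolynomial τ A ⧸ Q →+* A ⧸ Q.comap C, Function.Surjective f ∧
      ∀ i, f (Ideal.Quotient.mk Q (X i)) = 0 := by
  refine ⟨Ideal.Quotient.lift Q ((Ideal.Quotient.mk (Q.comap C)).comp constantCoeff) ?_, ?_, ?_⟩
  · intro p hp
    exact Ideal.Quotient.eq_zero_iff_mem.2 (C_coeff_zero_mem_of_isHomogeneous hQ hp)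
  · refine Ideal.Quotient.lift_surjective_of_surjective _ _ ?_
    refine Ideal.Quotient.mk_surjective.comp fun a => ⟨C a, constantCoeff_C _ a⟩
  · intro i
    simp

theorem comap_C_le_ker {τ A K : Type*} [CommRing A] [Field K] {Q : Ideal (MvPolynomial τ A)}
    {q : Ideal (MvPolynomial τ K)} (hq : q ≠ ⊤) {φ : A →+* K} (h : Q ≤ q.comap (map φ)) :
    Q.comap C ≤ RingHom.ker φ := by
  intro a ha
  by_contra h0
  have hmem : C (φ a) ∈ q := by simpa using h ha
  exact hq (Ideal.eq_top_of_isUnit_mem q hmem ((isUnit_iff_ne_zero.2 h0).map C))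

/-- The points over which the fibre of a family of cones has dimension at least `s` lie on
finitely many closed subvarieties of codimension at least `s` in the total space. -/
theorem exists_finite_ideals_of_le_ringKrullDim {K A τ : Type*} [Fintype τ] [Field K] [Infinite K]
    [CommRing A] [IsNoetherianRing A] [Algebra K A] {I : Ideal (MvPolynomial τ A)}
    (hI : I.IsHomogeneous (homogeneousSubmodule τ A)) {D : ℕ}
    (hD : ringKrullDim (MvPolynomial τ A ⧸ I) ≤ D) (s : ℕ) :
    ∃ S : Set (Ideal A), S.Finite ∧ (∀ P ∈ S, ringKrullDim (A ⧸ P) + s ≤ D) ∧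
      ∀ φ : A →ₐ[K] K,
        (s : WithBot ℕ∞) ≤ ringKrullDim (MvPolynomial τ K ⧸ I.map (map (φ : A →+* K))) →
        ∃ P ∈ S, P ≤ RingHom.ker φ := by
  have hdimle : ∀ Q : Ideal (MvPolynomial τ A), I ≤ Q → ringKrullDim (MvPolynomial τ A ⧸ Q) ≤ D :=
    fun Q hQ => (ringKrullDim_le_of_surjective _ (Ideal.Quotient.factor_surjective hQ)).trans hD
  cases s with
  | zero =>
    refine ⟨Ideal.comap C '' I.minimalPrimes,
      (Ideal.finite_minimalPrimes_of_isNoetherianRing _ I).image _, ?_, fun φ hφ => ?_⟩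
    · rintro _ ⟨Q, hQ, rfl⟩
      obtain ⟨f, hf, -⟩ := exists_surjective_quotient_comap_C
        (isHomogeneous_of_mem_minimalPrimes hI hQ)
      simpa using (ringKrullDim_le_of_surjective f hf).trans (hdimle Q hQ.1.2)
    · rw [Nat.cast_zero, zero_le_ringKrullDim_iff, Ideal.Quotient.nontrivial_iff] at hφ
      obtain ⟨q, hq, hIq⟩ := Ideal.exists_le_maximal _ hφ
      have := hq.isPrime
      obtain ⟨Q, hQ, hQq⟩ := Ideal.exists_minimalPrimes_le (Ideal.map_le_iff_le_comap.1 hIq)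
      exact ⟨_, ⟨Q, hQ, rfl⟩, comap_C_le_ker hq.ne_top hQq⟩
  | succ s =>
    rcases lt_or_ge D (s + 1) with hDs | hDs
    · refine ⟨∅, Set.finite_empty, by simp, fun φ hφ => ?_⟩
      have hsurj : Function.Surjective (φ : A →+* K) :=
        fun c => ⟨algebraMap K A c, φ.commutes c⟩
      have h := ringKrullDim_le_of_surjective
        (Ideal.quotientMap (I.map (map (φ : A →+* K))) (map (φ : A →+* K)) Ideal.le_comap_map)
        (Ideal.quotientMap_surjective (map_surjective _ hsurj))
      have h2 := (hφ.trans h).trans hD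
      have h3 : s + 1 ≤ D := by exact_mod_cast h2
      omega
    obtain ⟨t, rfl⟩ := Nat.exists_eq_add_of_le hDs
    have hoff : DimOffLT I (X : τ → MvPolynomial τ A) (t + 2 + s) := by
      intro Q _ hIQ _
      refine (hdimle Q hIQ).trans_lt ?_
      have : s + 1 + t < t + 2 + s := by omega
      exact_mod_cast this
    obtain ⟨L, hL, hoff'⟩ := hoff.exists_sup_span_image_linearCombination K
    set I' := I ⊔ Ideal.span (Fintype.linearCombination K X '' (L : Set (τ → K))) with hI'
    refine ⟨Ideal.comap C '' {Q ∈ I'.minimalPrimes | ∃ i, X i ∉ Q},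
      ((Ideal.finite_minimalPrimes_of_isNoetherianRing _ I').subset (Set.sep_subset _ _)).image _,
      ?_, fun φ hφ => ?_⟩
    · rintro _ ⟨Q, ⟨hQ, i, hi⟩, rfl⟩
      have := hQ.1.1
      obtain ⟨f, hf, hf0⟩ := exists_surjective_quotient_comap_C
        (isHomogeneous_of_mem_minimalPrimes (isHomogeneous_sup_span_linearCombination hI _) hQ)
      have h1 := ringKrullDim_succ_le_of_surjective f hf (mem_nonZeroDivisors_of_ne_zero
        fun h0 => hi (Ideal.Quotient.eq_zero_iff_mem.1 h0)) (hf0 i)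
      have h2 := lt_natCast_of_add_one_le h1 (d := t + 1) (hoff' Q hQ.1.1 hQ.1.2 ⟨i, hi⟩)
      have h3 : ringKrullDim (A ⧸ Q.comap C) ≤ t :=
        ENat.WithBot.lt_add_one_iff.1 (by exact_mod_cast h2)
      rw [add_comm (s + 1) t, Nat.cast_add t (s + 1)]
      gcongr
    · have hex : ∃ q : Ideal (MvPolynomial τ K), q.IsPrime ∧ I'.map (map (φ : A →+* K)) ≤ q ∧
          ∃ i, X i ∉ q := by
        by_contra! hcon
        obtain ⟨e, he⟩ := Ideal.exists_pow_le_of_le_radical_of_fg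
          (J := I'.map (map (φ : A →+* K))) (I := idealOfVars τ K) (by
            rw [Ideal.radical_eq_sInf]
            refine le_sInf fun q hq => ?_
            rw [idealOfVars, Ideal.span_le]
            rintro _ ⟨i, rfl⟩
            exact hcon q hq.2 hq.1 i) (idealOfVars_fg τ K)
        rw [hI', map_sup_span_linearCombination] at he
        have h1 := hφ.trans (ringKrullDim_le_card_of_pow_idealOfVars_le (isHomogeneous_map hI _) he)
        have h2 : s + 1 ≤ L.card := by exact_mod_cast h1
        omega
      obtain ⟨q, hq, hIq, i, hi⟩ := hex
      obtain ⟨Q, hQ, hQq⟩ := Ideal.exists_minimalPrimes_le (Ideal.map_le_iff_le_comap.1 hIq)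
      refine ⟨_, ⟨Q, ⟨hQ, i, fun hiQ => hi ?_⟩, rfl⟩, comap_C_le_ker hq.ne_top hQq⟩
      simpa using hQq hiQ

/-! ### The family of cones cut out by the partial derivatives -/

theorem exists_card_iUnion_integralPoints_le {K σ : Type} [Field K] [CharZero K] [Finite σ] {k : ℕ}
    {S : Set (Ideal (MvPolynomial σ K))} (hS : S.Finite)
    (hk : ∀ P ∈ S, ringKrullDim (MvPolynomial σ K ⧸ P) ≤ k) :
    ∃ C : ℕ, ∀ B : ℕ, 1 ≤ B → (⋃ P ∈ S, integralPoints P B).ncard ≤ C * B ^ k := by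
  induction S, hS using Set.Finite.induction_on with
  | empty => exact ⟨0, by simp⟩
  | @insert P S _ _ ih =>
    obtain ⟨C, hC⟩ := ih fun Q hQ => hk Q (Set.mem_insert_of_mem _ hQ)
    obtain ⟨C', hC'⟩ := exists_card_integralPoints_le P (hk P (Set.mem_insert _ _))
    refine ⟨C' + C, fun B hB => ?_⟩
    rw [Set.biUnion_insert, add_mul]
    exact (Set.ncard_union_le _ _).trans (add_le_add (hC' B hB) (hC B hB))

/-- The weights of the variables for the homogeneity in `(𝐲, 𝐳)`. -/
def weightYZ : Idx n m r → ℕ := Sum.elim (fun _ => 0) (fun _ => 1)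

/-- A polynomial in `(𝐱, 𝐲, 𝐳)` as a polynomial in `(𝐲, 𝐳)` over `ℂ[𝐱]`. -/
def toYZ : MvPolynomial (Idx n m r) ℤ →+*
    MvPolynomial (Fin (m - r) ⊕ Fin (n - m + 1)) (MvPolynomial (Fin (r + 1)) ℂ) :=
  eval₂Hom (Int.castRingHom _) (Sum.elim (fun i => C (X i)) X)

theorem coeff_coeff_eval₂_weightYZ (F : MvPolynomial (Idx n m r) ℤ) (k : ℕ)
    (μ : Idx n m r →₀ ℕ) :
    coeff μ ((eval₂ (Int.castRingHom _) (fun i => Polynomial.X ^ weightYZ i * Polynomial.C (X i)) F :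
      Polynomial (MvPolynomial (Idx n m r) ℤ)).coeff k) =
      if Finsupp.weight weightYZ μ = k then coeff μ F else 0 := by
  induction F using MvPolynomial.induction_on' with
  | add p q hp hq =>
    rw [eval₂_add, Polynomial.coeff_add, coeff_add, hp, hq, coeff_add]
    split_ifs <;> simp
  | monomial ν c =>
    have : (eval₂ (Int.castRingHom _)
        (fun i => Polynomial.X ^ weightYZ i * Polynomial.C (X i)) (monomial ν c) :
        Polynomial (MvPolynomial (Idx n m r) ℤ)) =
        Polynomial.monomial (Finsupp.weight weightYZ ν) (monomial ν c) := by
      rw [eval₂_monomial, Finsupp.weight_apply, Finsupp.sum, Finsupp.prod, monomial_eq,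
        Finsupp.prod, ← Polynomial.C_mul_X_pow_eq_monomial, map_mul, map_prod]
      simp only [mul_pow, Finset.prod_mul_distrib, ← pow_mul, Finset.prod_pow_eq_pow_sum,
        smul_eq_mul, map_pow, mul_comm (weightYZ _), eq_intCast, map_intCast]
      ring
    rw [this, Polynomial.coeff_monomial]
    by_cases h : ν = μ
    · subst h
      split_ifs <;> simp
    · split_ifs <;> simp [coeff_monomial, h]

theorem Bihomogeneous.isWeightedHomogeneous {F : MvPolynomial (Idx n m r) ℤ} {d₁ d₂ : ℕ}
    (hF : Bihomogeneous F d₁ d₂) : IsWeightedHomogeneous weightYZ F d₂ := by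
  intro μ hμ
  have h := hF (Polynomial (MvPolynomial (Idx n m r) ℤ)) 1 Polynomial.X
    (fun i => Polynomial.C (X (Sum.inl i))) (fun j => Polynomial.C (X (Sum.inr (Sum.inl j))))
    (fun k => Polynomial.C (X (Sum.inr (Sum.inr k))))
  have hl : (Sum.elim (fun i => Polynomial.C (X (Sum.inl i)))
      (Sum.elim (fun j => Polynomial.X * Polynomial.C (X (Sum.inr (Sum.inl j))))
        (fun k => Polynomial.X * Polynomial.C (X (Sum.inr (Sum.inr k))))) :
      Idx n m r → Polynomial (MvPolynomial (Idx n m r) ℤ)) =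
      fun i => Polynomial.X ^ weightYZ i * Polynomial.C (X i) := by
    ext1 i
    rcases i with i | i | i <;> simp [weightYZ]
  have hr : eval₂Hom (Int.castRingHom _) (Sum.elim (fun i => Polynomial.C (X (Sum.inl i)))
      (Sum.elim (fun j => Polynomial.C (X (Sum.inr (Sum.inl j))))
        (fun k => Polynomial.C (X (Sum.inr (Sum.inr k)))))) =
      (Polynomial.C : MvPolynomial (Idx n m r) ℤ →+* _) := by
    refine MvPolynomial.ringHom_ext (by simp) ?_
    rintro (i | i | i) <;> simp
  replace hr := RingHom.congr_fun hr F
  rw [coe_eval₂Hom] at hr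
  simp only [evalF, aeval_def, algebraMap_int_eq, one_mul, one_pow, hl, hr] at h
  replace h := congrArg (fun q => coeff μ (q.coeff d₂)) h
  simp only [coeff_coeff_eval₂_weightYZ, mul_comm _ (Polynomial.C F), Polynomial.coeff_C_mul_X_pow,
    if_true] at h
  by_contra hne
  rw [if_neg hne] at h
  exact hμ h.symm

theorem isHomogeneous_toYZ {p : MvPolynomial (Idx n m r) ℤ} {d : ℕ}
    (hp : IsWeightedHomogeneous weightYZ p d) : (toYZ p).IsHomogeneous d := by
  rw [p.as_sum, map_sum]
  refine IsHomogeneous.sum _ _ _ fun μ hμ => ?_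
  rw [toYZ, coe_eval₂Hom, eval₂_monomial, ← zero_add d, ← hp (mem_support_iff.1 hμ),
    Finsupp.weight_apply]
  refine IsHomogeneous.mul ?_ (IsHomogeneous.prod _ _ _ fun i _ => ?_)
  · have := isHomogeneous_C (Fin (m - r) ⊕ Fin (n - m + 1))
      ((coeff μ p : ℤ) : MvPolynomial (Fin (r + 1)) ℂ)
    simpa using this
  · simp only [smul_eq_mul]
    rw [mul_comm]
    refine IsHomogeneous.pow ?_ _
    rcases i with i | i
    · exact isHomogeneous_C _ _
    · exact isHomogeneous_X _ _

/-- The ideal of `V₂*` as a family of ideals of polynomials in `(𝐲, 𝐳)`. -/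
def idealYZ (F : MvPolynomial (Idx n m r) ℤ) :
    Ideal (MvPolynomial (Fin (m - r) ⊕ Fin (n - m + 1)) (MvPolynomial (Fin (r + 1)) ℂ)) :=
  Ideal.span (Set.range fun t => toYZ (pderiv (Sum.inr t) F))

theorem isHomogeneous_idealYZ {F : MvPolynomial (Idx n m r) ℤ} {d₁ d₂ : ℕ}
    (hF : Bihomogeneous F d₁ d₂) (hd₂ : 1 ≤ d₂) :
    (idealYZ F).IsHomogeneous (homogeneousSubmodule _ (MvPolynomial (Fin (r + 1)) ℂ)) := by
  refine Ideal.homogeneous_span _ _ ?_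
  rintro _ ⟨t, rfl⟩
  refine ⟨d₂ - 1, (mem_homogeneousSubmodule _ _).2 (isHomogeneous_toYZ ?_)⟩
  exact hF.isWeightedHomogeneous.pderiv (Nat.sub_add_cancel hd₂)

theorem ringKrullDim_quotient_idealYZ (F : MvPolynomial (Idx n m r) ℤ) :
    ringKrullDim (MvPolynomial (Fin (m - r) ⊕ Fin (n - m + 1)) (MvPolynomial (Fin (r + 1)) ℂ) ⧸
      idealYZ F) = dimV2 F := by
  let e : MvPolynomial (Idx n m r) ℂ ≃ₐ[ℂ]
      MvPolynomial (Fin (m - r) ⊕ Fin (n - m + 1)) (MvPolynomial (Fin (r + 1)) ℂ) :=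
    (renameEquiv ℂ (Equiv.sumComm _ _)).trans (sumAlgEquiv ℂ _ _)
  have he : ∀ i, e (pderivC F i) = toYZ (pderiv i F) := by
    intro i
    have : (e : MvPolynomial (Idx n m r) ℂ →+* _).comp (map (Int.castRingHom ℂ)) = toYZ := by
      refine MvPolynomial.ringHom_ext (by simp) ?_
      rintro (j | j) <;> simp [e, toYZ, sumAlgEquiv_X_inl, sumAlgEquiv_X_inr]
    exact RingHom.congr_fun this _
  refine (ringKrullDim_eq_of_ringEquiv (Ideal.quotientEquiv _ _ e.toRingEquiv ?_)).symm
  rw [idealV2, Ideal.map_span, idealYZ, ← Set.Sum.elim_range, ← Set.range_comp]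
  congr 2
  ext1 t
  rcases t with t | t <;> exact (he _).symm

theorem map_idealYZ (F : MvPolynomial (Idx n m r) ℤ) (x : Fin (r + 1) → ℂ) :
    ringKrullDim (MvPolynomial (Fin (m - r) ⊕ Fin (n - m + 1)) ℂ ⧸
      (idealYZ F).map (map ((aeval x : MvPolynomial (Fin (r + 1)) ℂ →ₐ[ℂ] ℂ) : MvPolynomial (Fin (r + 1)) ℂ →+* ℂ))) =
      dimV2x F x := by
  have he : ∀ p : MvPolynomial (Idx n m r) ℤ,
      map ((aeval x : MvPolynomial (Fin (r + 1)) ℂ →ₐ[ℂ] ℂ) : MvPolynomial (Fin (r + 1)) ℂ →+* ℂ) (toYZ p) = subsX x p := by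
    intro p
    have : (map ((aeval x : MvPolynomial (Fin (r + 1)) ℂ →ₐ[ℂ] ℂ) : MvPolynomial (Fin (r + 1)) ℂ →+* ℂ)).comp toYZ =
        (aeval (Sum.elim (fun i => C (x i))
          (Sum.elim (fun j => X (Sum.inl j)) (fun k => X (Sum.inr k)))) :
          MvPolynomial (Idx n m r) ℤ →ₐ[ℤ]
            MvPolynomial (Fin (m - r) ⊕ Fin (n - m + 1)) ℂ).toRingHom := by
      refine MvPolynomial.ringHom_ext (by simp) ?_
      rintro (j | j | j) <;> simp [toYZ]
    exact RingHom.congr_fun this p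
  have hr : ∀ t, map ((aeval x : MvPolynomial (Fin (r + 1)) ℂ →ₐ[ℂ] ℂ) :
      MvPolynomial (Fin (r + 1)) ℂ →+* ℂ) (toYZ (pderiv (Sum.inr t) F)) =
      Sum.elim (fun j => subsX x (pderiv (Sum.inr (Sum.inl j)) F))
        (fun k => subsX x (pderiv (Sum.inr (Sum.inr k)) F)) t := by
    rintro (t | t) <;> exact he _
  rw [idealYZ, Ideal.map_span, dimV2x, ← Set.Sum.elim_range, ← Set.range_comp, ← funext hr]
  rfl

theorem notMem_A2set_iff (F : MvPolynomial (Idx n m r) ℤ) (lam D₂ : ℕ) (x : Fin (r + 1) → ℂ) :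
    x ∉ A2set F lam D₂ ↔ ((D₂ + lam - (r + 1) : ℕ) : WithBot ℕ∞) ≤ dimV2x F x := by
  rw [A2set, Set.mem_ofPred_eq, not_lt]
  generalize dimV2x F x = d
  have key : ∀ d : ℕ, D₂ + lam ≤ d + (r + 1) ↔ D₂ + lam - (r + 1) ≤ d := by omega
  generalize D₂ + lam - (r + 1) = s at key ⊢
  generalize D₂ + lam = t at key ⊢
  generalize r + 1 = u at key ⊢
  induction d with
  | bot => simp
  | coe d =>
    induction d with
    | top => exact iff_of_true le_top le_top
    | coe d => exact_mod_cast key d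

theorem exists_compl_A2set_eq {F : MvPolynomial (Idx n m r) ℤ} {d₁ d₂ : ℕ} (hd₂ : 1 ≤ d₂)
    (hF : Bihomogeneous F d₁ d₂) (lam D₂ : ℕ) :
    ∃ T : Set (MvPolynomial (Fin (r + 1)) ℂ),
      (A2set F lam D₂)ᶜ = {x : Fin (r + 1) → ℂ | ∀ p ∈ T, eval x p = 0} := by
  refine ⟨{p | ∀ x ∈ (A2set F lam D₂)ᶜ, eval x p = 0}, Set.Subset.antisymm
    (fun x hx p hp => hp x hx) fun x hx hxA => ?_⟩
  have hlt := mt (notMem_A2set_iff F lam D₂ x).2 (not_not.2 hxA)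
  rw [← map_idealYZ, not_le] at hlt
  obtain ⟨a, ha, h⟩ := exists_ne_zero_forall_ringKrullDim_lt (isHomogeneous_idealYZ hF hd₂) hlt
  refine ha ?_
  rw [aeval_eq_eval]
  refine hx a fun y hy => ?_
  by_contra hya
  have hy' := h (aeval y) (by rwa [aeval_eq_eval])
  rw [map_idealYZ] at hy'
  exact hy'.not_ge ((notMem_A2set_iff F lam D₂ y).1 hy)

theorem exists_ncard_compl_A2set_le {F : MvPolynomial (Idx n m r) ℤ} {d₁ d₂ : ℕ} (hd₂ : 1 ≤ d₂)
    (hF : Bihomogeneous F d₁ d₂) {D₂ : ℕ} (hD₂ : dimV2 F = ((D₂ : ℕ∞) : WithBot ℕ∞)) (lam : ℕ) :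
    ∃ Cc : ℝ, 0 < Cc ∧ ∀ P₁ : ℝ, 1 ≤ P₁ →
      (Set.ncard {x : Fin (r + 1) → ℤ |
          ‖x‖ ≤ P₁ ∧ (fun i => (x i : ℂ)) ∉ A2set F lam D₂} : ℝ) ≤
        Cc * P₁ ^ ((r : ℤ) + 1 - lam) := by
  obtain ⟨S, hS, hdim, hker⟩ := exists_finite_ideals_of_le_ringKrullDim (K := ℂ) (D := D₂)
    (isHomogeneous_idealYZ hF hd₂) ((ringKrullDim_quotient_idealYZ F).trans_le hD₂.le)
    (D₂ + lam - (r + 1))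
  have hmem : ∀ x : Fin (r + 1) → ℂ, x ∉ A2set F lam D₂ →
      ∃ P ∈ S, P ≤ RingHom.ker (aeval x : MvPolynomial (Fin (r + 1)) ℂ →ₐ[ℂ] ℂ) := by
    intro x hx
    refine hker (aeval x) ?_
    rw [map_idealYZ]
    exact (notMem_A2set_iff F lam D₂ x).1 hx
  have hk : ∀ P ∈ S, ringKrullDim (MvPolynomial (Fin (r + 1)) ℂ ⧸ P) ≤
      (D₂ - (D₂ + lam - (r + 1)) : ℕ) := by
    intro P hP
    have h := hdim P hP
    generalize ringKrullDim (MvPolynomial (Fin (r + 1)) ℂ ⧸ P) = d at h ⊢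
    generalize D₂ + lam - (r + 1) = s at h ⊢
    induction d with
    | bot => simp
    | coe d =>
      induction d with
      | top =>
        have h' : (⊤ : ℕ∞) + s ≤ (D₂ : ℕ∞) := WithBot.coe_le_coe.1 h
        simp at h'
      | coe d =>
        have h' : d + s ≤ D₂ := by exact_mod_cast h
        have : d ≤ D₂ - s := by omega
        generalize D₂ - s = t at this ⊢
        exact_mod_cast this
  obtain ⟨C, hC⟩ := exists_card_iUnion_integralPoints_le hS hk
  refine ⟨C + 1, by positivity, fun P₁ hP₁ => ?_⟩
  by_cases hs : D₂ < D₂ + lam - (r + 1)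
  · have : {x : Fin (r + 1) → ℤ | ‖x‖ ≤ P₁ ∧ (fun i => (x i : ℂ)) ∉ A2set F lam D₂} = ∅ := by
      refine Set.eq_empty_of_forall_notMem fun x hx => ?_
      obtain ⟨P, hP, hPk⟩ := hmem _ hx.2
      have : Nontrivial (MvPolynomial (Fin (r + 1)) ℂ ⧸ P) :=
        Ideal.Quotient.nontrivial_iff.2 fun h => (RingHom.ker_ne_top
          (aeval fun i => (x i : ℂ) : MvPolynomial (Fin (r + 1)) ℂ →ₐ[ℂ] ℂ)) (top_le_iff.1 (h ▸ hPk))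
      have h := (add_le_add_left (zero_le_ringKrullDim_iff.2 this) _).trans (hdim P hP)
      rw [zero_add] at h
      generalize D₂ + lam - (r + 1) = s at h hs
      exact absurd (by exact_mod_cast h) hs.not_ge
    rw [this, Set.ncard_empty, Nat.cast_zero]
    positivity
  · have hB : 1 ≤ ⌊P₁⌋₊ := Nat.le_floor (by simpa using hP₁)
    have hsub : {x : Fin (r + 1) → ℤ | ‖x‖ ≤ P₁ ∧ (fun i => (x i : ℂ)) ∉ A2set F lam D₂} ⊆
        ⋃ P ∈ S, integralPoints P ⌊P₁⌋₊ := by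
      rintro x ⟨hx, hxA⟩
      obtain ⟨P, hP, hPk⟩ := hmem _ hxA
      refine Set.mem_biUnion hP ⟨fun i => ?_, fun p hp => ?_⟩
      · have h : (x i).natAbs ≤ ⌊P₁⌋₊ := by
          refine Nat.le_floor ?_
          rw [Nat.cast_natAbs, Int.cast_abs, ← Int.norm_eq_abs]
          exact (norm_le_pi_norm x i).trans hx
        rw [Finset.mem_Icc]
        omega
      · exact hPk hp
    refine (Nat.cast_le.2 ((Set.ncard_le_ncard hsub
      (hS.biUnion fun P _ => finite_integralPoints P _)).trans (hC _ hB))).trans ?_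
    push_cast
    have hB' : ((⌊P₁⌋₊ : ℕ) : ℝ) ≤ P₁ := Nat.floor_le (by linarith)
    refine mul_le_mul (by linarith) ?_ (by positivity) (by positivity)
    refine (pow_le_pow_left₀ (by positivity) hB' _).trans ?_
    rw [← zpow_natCast]
    exact zpow_le_zpow_right₀ hP₁ (by omega)

/-!
Statement 11: for every `λ ∈ ℕ` the set `A₂^λ` is a Zariski-open subset of `ℂ^{r+1}`
(its complement is the common zero set of a family of polynomials), and moreover
`#{𝐱 ∈ ℤ^{r+1} : |𝐱| ≤ P₁, 𝐱 ∉ A₂^λ} ≪ P₁^{r+1-λ}` for all `P₁ ≥ 1`, the implied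
constant depending only on `F` and `λ`.
-/
theorem statement11
    (n m r d₁ d₂ : ℕ) (hr1 : 1 ≤ r) (hrm : r ≤ m) (hmn : m ≤ n)
    (hd₁ : 1 ≤ d₁) (hd₂ : 1 ≤ d₂)
    (F : MvPolynomial (Idx n m r) ℤ) (hF : Bihomogeneous F d₁ d₂)
    (D₂ : ℕ) (hD₂ : dimV2 F = ((D₂ : ℕ∞) : WithBot ℕ∞)) (lam : ℕ) :
    (∃ T : Set (MvPolynomial (Fin (r + 1)) ℂ),
        (A2set F lam D₂)ᶜ =
          {x : Fin (r + 1) → ℂ | ∀ p ∈ T, MvPolynomial.eval x p = 0}) ∧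
      ∃ Cc : ℝ, 0 < Cc ∧ ∀ P₁ : ℝ, 1 ≤ P₁ →
        (Set.ncard {x : Fin (r + 1) → ℤ |
            ‖x‖ ≤ P₁ ∧ (fun i => (x i : ℂ)) ∉ A2set F lam D₂} : ℝ) ≤
          Cc * P₁ ^ ((r : ℤ) + 1 - lam) :=
  ⟨exists_compl_A2set_eq hd₂ hF lam D₂, exists_ncard_compl_A2set_le hd₂ hF hD₂ lam⟩

end PaperTM
end
end
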